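/- arXiv:1004.4589 — 2 statements merged into one kernel-verified Lean document; each statement's English description precedes it below -/
import Mathlib

section
/- Let n ≥ 3 and let f ∈ L¹(ℝⁿ). Define u(x) = ∫_{ℝⁿ} K_n(x−y) f(y) dy, where K_n(x) = |x|^{2−n}/((2−n)ω_n). Then u(x) is defined (the integral converges absolutely) for almost every x ∈ ℝⁿ, u is locally integrable on ℝⁿ, and u solves the Poisson equation Δu = f in the sense of distributions: for every smooth compactly supported φ : ℝⁿ → ℝ one has ∫_{ℝⁿ} u(x) Δφ(x) dx = ∫_{ℝⁿ} f(x) φ(x) dx. -/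
open MeasureTheory Set Filter Topology

noncomputable section

/-- Spatial partial derivative in coordinate direction `j`. -/
noncomputable def pd {n : ℕ} (j : Fin n) (f : EuclideanSpace ℝ (Fin n) → ℝ)
    (x : EuclideanSpace ℝ (Fin n)) : ℝ :=
  fderiv ℝ f x (EuclideanSpace.single j 1)

/-- Surface area of the unit sphere in ℝⁿ. -/
noncomputable def sphereArea (n : ℕ) : ℝ :=
  n * (volume (Metric.ball (0 : EuclideanSpace ℝ (Fin n)) 1)).toReal

/-- Poisson (Newtonian potential) kernel `K_n x = |x|^(2-n) / ((2-n) ω_n)`. -/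
noncomputable def poissonK (n : ℕ) (x : EuclideanSpace ℝ (Fin n)) : ℝ :=
  ‖x‖ ^ ((2 : ℝ) - n) / (((2 : ℝ) - n) * sphereArea n)

section RadialIntegral

/-- The radial antiderivative behind the normalization of the Laplacian of the regularized
kernel. -/
theorem hasDerivAt_pow_mul_one_add_sq_rpow (n : ℕ) (hn : 1 ≤ n) (r : ℝ) :
    HasDerivAt (fun r : ℝ => r ^ n * (1 + r ^ 2) ^ (-(n : ℝ) / 2))
      (n * (r ^ (n - 1) * (1 + r ^ 2) ^ (-(n : ℝ) / 2 - 1))) r := by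
  have hpos : 0 < 1 + r ^ 2 := by positivity
  have h1 : HasDerivAt (fun r : ℝ => 1 + r ^ 2) (2 * r) r := by
    simpa using (hasDerivAt_pow 2 r).const_add 1
  refine ((hasDerivAt_pow n r).mul
    (h1.rpow_const (p := -(n : ℝ) / 2) (Or.inl hpos.ne'))).congr_deriv ?_
  obtain ⟨m, rfl⟩ : ∃ m, n = m + 1 := ⟨n - 1, by omega⟩
  have h2 : (1 + r ^ 2) ^ (-((m + 1 : ℕ) : ℝ) / 2)
      = (1 + r ^ 2) ^ (-((m + 1 : ℕ) : ℝ) / 2 - 1) * (1 + r ^ 2) := by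
    rw [Real.rpow_sub_one hpos.ne']
    field_simp
  rw [h2]
  push_cast
  ring

theorem tendsto_pow_mul_one_add_sq_rpow (n : ℕ) :
    Tendsto (fun r : ℝ => r ^ n * (1 + r ^ 2) ^ (-(n : ℝ) / 2)) atTop (𝓝 1) := by
  have h1 : Tendsto (fun r : ℝ => ((1 + (r ^ 2)⁻¹) : ℝ) ^ (-(n : ℝ) / 2)) atTop (𝓝 1) := by
    have h2 : Tendsto (fun r : ℝ => (1 + (r ^ 2)⁻¹ : ℝ)) atTop (𝓝 (1 + 0)) :=
      ((tendsto_pow_atTop two_ne_zero).inv_tendsto_atTop).const_add 1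
    simpa using h2.rpow_const (p := -(n : ℝ) / 2) (Or.inl (by norm_num))
  refine h1.congr' ?_
  filter_upwards [eventually_gt_atTop 0] with r hr
  have h3 : 1 + r ^ 2 = r ^ 2 * (1 + (r ^ 2)⁻¹) := by field_simp; ring
  have h4 : (r ^ 2) ^ (-(n : ℝ) / 2) = (r ^ n)⁻¹ := by
    rw [← Real.rpow_natCast r 2, ← Real.rpow_mul hr.le, ← Real.rpow_natCast r n,
      ← Real.rpow_neg hr.le]
    congr 1
    push_cast
    ring
  rw [h3, Real.mul_rpow (by positivity) (by positivity), h4, ← mul_assoc,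
    mul_inv_cancel₀ (by positivity), one_mul]

theorem integral_one_add_norm_sq_rpow (n : ℕ) (hn : 1 ≤ n) :
    ∫ x : EuclideanSpace ℝ (Fin n), n * (1 + ‖x‖ ^ 2) ^ (-(n : ℝ) / 2 - 1) = sphereArea n := by
  have : Nontrivial (EuclideanSpace ℝ (Fin n)) := by
    have : Nonempty (Fin n) := ⟨⟨0, hn⟩⟩
    infer_instance
  rw [integral_fun_norm_addHaar volume (fun r : ℝ => (n * (1 + r ^ 2) ^ (-(n : ℝ) / 2 - 1) : ℝ))]
  have h := integral_Ioi_of_hasDerivAt_of_nonneg' (a := 0)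
    (fun r _ => hasDerivAt_pow_mul_one_add_sq_rpow n hn r)
    (fun r (hr : 0 < r) => by positivity) (tendsto_pow_mul_one_add_sq_rpow n)
  have h0 : (n : ℕ) ≠ 0 := by omega
  simp only [finrank_euclideanSpace, Fintype.card_fin, smul_eq_mul, nsmul_eq_mul, sphereArea]
  have h2 : (fun r : ℝ => r ^ (n - 1) * (n * (1 + r ^ 2) ^ (-(n : ℝ) / 2 - 1) : ℝ))
      = fun r : ℝ => n * (r ^ (n - 1) * (1 + r ^ 2) ^ (-(n : ℝ) / 2 - 1)) := by
    ext r; ring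
  rw [h2, h]
  simp [h0, Measure.real]

end RadialIntegral

theorem sphereArea_pos (n : ℕ) (hn : 1 ≤ n) : 0 < sphereArea n := by
  have : 0 < (volume (Metric.ball (0 : EuclideanSpace ℝ (Fin n)) 1)).toReal :=
    ENNReal.toReal_pos (Metric.measure_ball_pos _ _ one_pos).ne' measure_ball_lt_top.ne
  have : (0 : ℝ) < n := by exact_mod_cast hn
  unfold sphereArea
  positivity

section PartialDerivatives

variable {n : ℕ}

theorem ContDiff.pd {f : EuclideanSpace ℝ (Fin n) → ℝ} (hf : ContDiff ℝ (⊤ : ℕ∞) f)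
    (j : Fin n) : ContDiff ℝ (⊤ : ℕ∞) (pd j f) :=
  (hf.fderiv_right (m := (⊤ : ℕ∞)) (by simp)).clm_apply contDiff_const

theorem HasCompactSupport.pd {f : EuclideanSpace ℝ (Fin n) → ℝ} (hf : HasCompactSupport f)
    (j : Fin n) : HasCompactSupport (pd j f) :=
  hf.fderiv_apply ℝ _

theorem pd_comp_add_right (j : Fin n) (f : EuclideanSpace ℝ (Fin n) → ℝ)
    (y : EuclideanSpace ℝ (Fin n)) :
    pd j (fun x => f (x + y)) = fun x => pd j f (x + y) := by
  ext x
  simp [pd, fderiv_comp_add_right]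

theorem integral_mul_pd {g φ : EuclideanSpace ℝ (Fin n) → ℝ} (hg : ContDiff ℝ (⊤ : ℕ∞) g)
    (hφ : ContDiff ℝ (⊤ : ℕ∞) φ) (hc : HasCompactSupport φ) (j : Fin n) :
    ∫ x, g x * pd j φ x = -∫ x, pd j g x * φ x :=
  integral_mul_fderiv_eq_neg_fderiv_mul_of_integrable
    (((hg.pd j).continuous.mul hφ.continuous).integrable_of_hasCompactSupport hc.mul_left)
    ((hg.continuous.mul (hφ.pd j).continuous).integrable_of_hasCompactSupport (hc.pd j).mul_left)
    ((hg.continuous.mul hφ.continuous).integrable_of_hasCompactSupport hc.mul_left)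
    (fun x _ => hg.differentiable (by simp) x) (fun x _ => hφ.differentiable (by simp) x)

theorem contDiff_laplacian {φ : EuclideanSpace ℝ (Fin n) → ℝ} (hφ : ContDiff ℝ (⊤ : ℕ∞) φ) :
    ContDiff ℝ (⊤ : ℕ∞) (fun x => ∑ j, pd j (pd j φ) x) :=
  ContDiff.sum fun j _ => (hφ.pd j).pd j

theorem hasCompactSupport_laplacian {φ : EuclideanSpace ℝ (Fin n) → ℝ}
    (hc : HasCompactSupport φ) : HasCompactSupport (fun x => ∑ j, pd j (pd j φ) x) := by
  refine HasCompactSupport.intro hc fun x hx => Finset.sum_eq_zero fun j _ => ?_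
  have h1 : x ∉ tsupport (pd j φ) := fun h => hx (tsupport_fderiv_apply_subset ℝ _ h)
  exact image_eq_zero_of_notMem_tsupport fun h => h1 (tsupport_fderiv_apply_subset ℝ _ h)

theorem integral_mul_laplacian {g φ : EuclideanSpace ℝ (Fin n) → ℝ}
    (hg : ContDiff ℝ (⊤ : ℕ∞) g) (hφ : ContDiff ℝ (⊤ : ℕ∞) φ) (hc : HasCompactSupport φ) :
    ∫ x, g x * ∑ j, pd j (pd j φ) x = ∫ x, (∑ j, pd j (pd j g) x) * φ x := by
  simp only [Finset.mul_sum, Finset.sum_mul]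
  rw [integral_finsetSum, integral_finsetSum]
  · refine Finset.sum_congr rfl fun j _ => ?_
    rw [integral_mul_pd hg (hφ.pd j) (hc.pd j), integral_mul_pd (hg.pd j) hφ hc, neg_neg]
  · exact fun j _ => (((hg.pd j).pd j).continuous.mul
      hφ.continuous).integrable_of_hasCompactSupport hc.mul_left
  · exact fun j _ => (hg.continuous.mul
      ((hφ.pd j).pd j).continuous).integrable_of_hasCompactSupport ((hc.pd j).pd j).mul_left

theorem contDiff_norm_sq_add_rpow {ε : ℝ} (hε : 0 < ε) (s : ℝ) :
    ContDiff ℝ (⊤ : ℕ∞) (fun x : EuclideanSpace ℝ (Fin n) => (‖x‖ ^ 2 + ε) ^ s) :=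
  ((contDiff_norm_sq ℝ).add contDiff_const).rpow_const_of_ne fun x => by positivity

theorem pd_norm_sq_add_rpow {ε : ℝ} (hε : 0 < ε) (s : ℝ) (j : Fin n)
    (x : EuclideanSpace ℝ (Fin n)) :
    pd j (fun x => (‖x‖ ^ 2 + ε) ^ s) x = 2 * s * (x j * (‖x‖ ^ 2 + ε) ^ (s - 1)) := by
  have h1 : HasFDerivAt (fun x : EuclideanSpace ℝ (Fin n) => ‖x‖ ^ 2 + ε)
      (2 • innerSL ℝ x) x := (hasStrictFDerivAt_norm_sq x).hasFDerivAt.add_const ε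
  have h2 := h1.rpow_const (p := s) (Or.inl (by positivity))
  rw [pd, h2.fderiv]
  simp [EuclideanSpace.inner_single_right]
  ring

theorem laplacian_norm_sq_add_rpow {ε : ℝ} (hε : 0 < ε) (s : ℝ)
    (x : EuclideanSpace ℝ (Fin n)) :
    ∑ j, pd j (pd j (fun x => (‖x‖ ^ 2 + ε) ^ s)) x
      = 2 * s * (n * (‖x‖ ^ 2 + ε) ^ (s - 1)
        + 2 * (s - 1) * ‖x‖ ^ 2 * (‖x‖ ^ 2 + ε) ^ (s - 2)) := by
  have key (j : Fin n) : pd j (pd j (fun x => (‖x‖ ^ 2 + ε) ^ s)) x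
      = 2 * s * ((‖x‖ ^ 2 + ε) ^ (s - 1)
        + 2 * (s - 1) * (x j ^ 2 * (‖x‖ ^ 2 + ε) ^ (s - 2))) := by
    have h1 : pd j (fun x : EuclideanSpace ℝ (Fin n) => (‖x‖ ^ 2 + ε) ^ s)
        = fun x => 2 * s * (x j * (‖x‖ ^ 2 + ε) ^ (s - 1)) := by
      ext x
      exact pd_norm_sq_add_rpow hε s j x
    have h2 : HasFDerivAt (fun x : EuclideanSpace ℝ (Fin n) => x j)
        (EuclideanSpace.proj j : EuclideanSpace ℝ (Fin n) →L[ℝ] ℝ) x :=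
      (EuclideanSpace.proj j : EuclideanSpace ℝ (Fin n) →L[ℝ] ℝ).hasFDerivAt
    have h3 := (contDiff_norm_sq_add_rpow (n := n) hε (s - 1)).differentiable (by simp) x
    have h4 := (h2.fun_mul h3.hasFDerivAt).const_mul (2 * s)
    have h5 := pd_norm_sq_add_rpow hε (s - 1) j x
    rw [pd] at h5
    rw [h1, pd]
    rw [h4.fderiv]
    simp [h5]
    rw [show s - 1 - 1 = s - 2 by ring]
    ring
  simp only [key, ← Finset.mul_sum, Finset.sum_add_distrib, ← Finset.sum_mul]
  rw [EuclideanSpace.real_norm_sq_eq]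
  simp only [Finset.sum_const, Finset.card_univ, Fintype.card_fin, nsmul_eq_mul]
  ring

theorem laplacian_norm_sq_add_rpow_critical {ε : ℝ} (hε : 0 < ε)
    (x : EuclideanSpace ℝ (Fin n)) :
    ∑ j, pd j (pd j (fun x => (‖x‖ ^ 2 + ε) ^ ((2 - n : ℝ) / 2))) x
      = (2 - n) * (n * ε * (‖x‖ ^ 2 + ε) ^ (-(n : ℝ) / 2 - 1)) := by
  have hpos : 0 < ‖x‖ ^ 2 + ε := by positivity
  rw [laplacian_norm_sq_add_rpow hε]
  have h1 : (2 - n : ℝ) / 2 - 2 = -(n : ℝ) / 2 - 1 := by ring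
  have h2 : (2 - n : ℝ) / 2 - 1 = (-(n : ℝ) / 2 - 1) + 1 := by ring
  rw [h1, h2, Real.rpow_add_one hpos.ne']
  ring

end PartialDerivatives

section FundamentalSolution

variable {n : ℕ}

theorem tendsto_integral_laplacian_regularized (hn : 1 ≤ n)
    {φ : EuclideanSpace ℝ (Fin n) → ℝ} (hφ : Continuous φ) (hc : HasCompactSupport φ) :
    Tendsto (fun c : ℝ => ∫ x : EuclideanSpace ℝ (Fin n),
      (n * (c ^ 2)⁻¹ * (‖x‖ ^ 2 + (c ^ 2)⁻¹) ^ (-(n : ℝ) / 2 - 1)) * φ x)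
      atTop (𝓝 (sphereArea n * φ 0)) := by
  have hω := sphereArea_pos n hn
  have h := tendsto_integral_comp_smul_smul_of_integrable (μ := volume)
    (φ := fun x : EuclideanSpace ℝ (Fin n) =>
      (sphereArea n)⁻¹ * (n * (1 + ‖x‖ ^ 2) ^ (-(n : ℝ) / 2 - 1)))
    (g := φ) (fun x => by positivity)
    (by rw [integral_const_mul, integral_one_add_norm_sq_rpow n hn, inv_mul_cancel₀ hω.ne'])
    ?_ (hφ.integrable_of_hasCompactSupport hc) hφ.continuousAt
  · refine (h.const_mul (sphereArea n)).congr' ?_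
    filter_upwards [eventually_gt_atTop 0] with c hc0
    rw [← integral_const_mul]
    congr 1
    ext x
    have h1 : 1 + ‖c • x‖ ^ 2 = c ^ 2 * (‖x‖ ^ 2 + (c ^ 2)⁻¹) := by
      rw [norm_smul, mul_pow, Real.norm_eq_abs, sq_abs]
      field_simp
      ring
    have h2 : (c ^ 2) ^ (-(n : ℝ) / 2 - 1) = (c ^ n)⁻¹ * (c ^ 2)⁻¹ := by
      rw [Real.rpow_sub_one (by positivity), div_eq_mul_inv]
      congr 1
      rw [← Real.rpow_natCast c 2, ← Real.rpow_mul hc0.le, ← Real.rpow_natCast c n,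
        ← Real.rpow_neg hc0.le]
      congr 1
      push_cast
      ring
    rw [h1, Real.mul_rpow (by positivity) (by positivity), h2]
    simp only [finrank_euclideanSpace, Fintype.card_fin, smul_eq_mul]
    field_simp
  · have h1 : Tendsto (fun x : EuclideanSpace ℝ (Fin n) =>
        (sphereArea n)⁻¹ * (n * (1 + ‖x‖ ^ 2)⁻¹)) (Bornology.cobounded _) (𝓝 0) := by
      have h2 : Tendsto (fun x : EuclideanSpace ℝ (Fin n) => 1 + ‖x‖ ^ 2)
          (Bornology.cobounded _) atTop :=
        tendsto_atTop_add_const_left _ _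
          ((tendsto_pow_atTop two_ne_zero).comp tendsto_norm_cobounded_atTop)
      simpa using (h2.inv_tendsto_atTop.const_mul (n : ℝ)).const_mul (sphereArea n)⁻¹
    refine squeeze_zero (fun x => by positivity) (fun x => ?_) h1
    have hpos : 0 < 1 + ‖x‖ ^ 2 := by positivity
    have h3 : ‖x‖ ^ n ≤ (1 + ‖x‖ ^ 2) ^ ((n : ℝ) / 2) := by
      calc ‖x‖ ^ n = (‖x‖ ^ 2) ^ ((n : ℝ) / 2) := by
            rw [← Real.rpow_natCast _ 2, ← Real.rpow_mul (norm_nonneg x), ← Real.rpow_natCast]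
            congr 1
            push_cast
            ring
        _ ≤ _ := by gcongr; linarith
    have h4 : (1 + ‖x‖ ^ 2) ^ (-(n : ℝ) / 2 - 1)
        = ((1 + ‖x‖ ^ 2) ^ ((n : ℝ) / 2))⁻¹ * (1 + ‖x‖ ^ 2)⁻¹ := by
      rw [Real.rpow_sub_one hpos.ne', div_eq_mul_inv, neg_div, Real.rpow_neg hpos.le]
    simp only [finrank_euclideanSpace, Fintype.card_fin]
    rw [h4]
    calc ‖x‖ ^ n * ((sphereArea n)⁻¹
          * (n * (((1 + ‖x‖ ^ 2) ^ ((n : ℝ) / 2))⁻¹ * (1 + ‖x‖ ^ 2)⁻¹)))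
        ≤ (1 + ‖x‖ ^ 2) ^ ((n : ℝ) / 2) * ((sphereArea n)⁻¹
          * (n * (((1 + ‖x‖ ^ 2) ^ ((n : ℝ) / 2))⁻¹ * (1 + ‖x‖ ^ 2)⁻¹))) := by gcongr
      _ = _ := by
        have := Real.rpow_pos_of_pos hpos ((n : ℝ) / 2)
        field_simp

theorem measurable_poissonK : Measurable (poissonK n) := by
  unfold poissonK
  fun_prop

theorem locallyIntegrable_norm_rpow_two_sub (hn : 1 ≤ n) :
    LocallyIntegrable (fun x : EuclideanSpace ℝ (Fin n) => ‖x‖ ^ ((2 : ℝ) - n)) := by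
  refine locallyIntegrable_of_norm_le_rpow (C := 1) (α := (n : ℝ) - 2) (by simpa using hn)
    (by simp) (Eventually.of_forall fun x => ?_)
    (by fun_prop : Measurable fun x : EuclideanSpace ℝ (Fin n) =>
      ‖x‖ ^ ((2 : ℝ) - n)).aestronglyMeasurable
  rw [Real.norm_of_nonneg (by positivity), neg_sub, one_mul]

theorem integral_norm_rpow_mul_laplacian (hn : 3 ≤ n)
    {φ : EuclideanSpace ℝ (Fin n) → ℝ} (hφ : ContDiff ℝ (⊤ : ℕ∞) φ) (hc : HasCompactSupport φ) :
    ∫ x, ‖x‖ ^ ((2 : ℝ) - n) * ∑ j, pd j (pd j φ) x = (2 - n) * (sphereArea n * φ 0) := by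
  have hn' : (3 : ℝ) ≤ n := by exact_mod_cast hn
  have : Nontrivial (EuclideanSpace ℝ (Fin n)) := by
    have : Nonempty (Fin n) := ⟨⟨0, by omega⟩⟩
    infer_instance
  have hΔ := (contDiff_laplacian hφ).continuous
  have hΔc := hasCompactSupport_laplacian hc
  have h1 := (tendsto_integral_laplacian_regularized (by omega) hφ.continuous hc).const_mul
    (2 - n : ℝ)
  have h2 : Tendsto (fun c : ℝ => ∫ x : EuclideanSpace ℝ (Fin n),
      (‖x‖ ^ 2 + (c ^ 2)⁻¹) ^ ((2 - n : ℝ) / 2) * ∑ j, pd j (pd j φ) x) atTop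
      (𝓝 (∫ x, ‖x‖ ^ ((2 : ℝ) - n) * ∑ j, pd j (pd j φ) x)) := by
    have hsq (x : EuclideanSpace ℝ (Fin n)) :
        (‖x‖ ^ 2) ^ ((2 - n : ℝ) / 2) = ‖x‖ ^ ((2 : ℝ) - n) := by
      rw [← Real.rpow_natCast _ 2, ← Real.rpow_mul (norm_nonneg x)]
      congr 1
      push_cast
      ring
    have hne : ∀ᵐ x : EuclideanSpace ℝ (Fin n), x ≠ 0 := Measure.ae_ne volume 0
    refine tendsto_integral_filter_of_dominated_convergence
      (fun x => ‖‖x‖ ^ ((2 : ℝ) - n) * ∑ j, pd j (pd j φ) x‖) ?_ ?_ ?_ ?_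
    · refine Eventually.of_forall fun c => ?_
      exact ((by fun_prop : Measurable fun x : EuclideanSpace ℝ (Fin n) =>
        (‖x‖ ^ 2 + (c ^ 2)⁻¹) ^ ((2 - n : ℝ) / 2)).mul hΔ.measurable).aestronglyMeasurable
    · filter_upwards [eventually_gt_atTop 0] with c hc0
      filter_upwards [hne] with x hx
      have hx0 : 0 < ‖x‖ := norm_pos_iff.2 hx
      rw [norm_mul, norm_mul]
      gcongr
      rw [Real.norm_of_nonneg (by positivity), Real.norm_of_nonneg (by positivity), ← hsq]
      exact Real.rpow_le_rpow_of_nonpos (by positivity)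
        (le_add_of_nonneg_right (by positivity)) (by linarith)
    · refine Integrable.norm ?_
      simpa [mul_comm] using
        (locallyIntegrable_norm_rpow_two_sub (n := n)
          (by omega)).integrable_smul_left_of_hasCompactSupport hΔ hΔc
    · filter_upwards [hne] with x hx
      have hx0 : 0 < ‖x‖ := norm_pos_iff.2 hx
      refine Tendsto.mul_const _ ?_
      rw [← hsq]
      have h3 : Tendsto (fun c : ℝ => ‖x‖ ^ 2 + (c ^ 2)⁻¹) atTop (𝓝 (‖x‖ ^ 2 + 0)) :=
        ((tendsto_pow_atTop two_ne_zero).inv_tendsto_atTop).const_add _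
      rw [add_zero] at h3
      exact h3.rpow_const (Or.inl (by positivity))
  refine tendsto_nhds_unique h2 (h1.congr' ?_)
  filter_upwards [eventually_gt_atTop 0] with c hc0
  have hε : 0 < (c ^ 2)⁻¹ := by positivity
  rw [integral_mul_laplacian (contDiff_norm_sq_add_rpow hε _) hφ hc, ← integral_const_mul]
  congr 1
  ext x
  rw [laplacian_norm_sq_add_rpow_critical hε]
  ring

/-- `poissonK n` is a fundamental solution of the Laplacian. -/
theorem integral_poissonK_sub_mul_laplacian (hn : 3 ≤ n)
    {φ : EuclideanSpace ℝ (Fin n) → ℝ} (hφ : ContDiff ℝ (⊤ : ℕ∞) φ) (hc : HasCompactSupport φ)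
    (y : EuclideanSpace ℝ (Fin n)) :
    ∫ x, poissonK n (x - y) * ∑ j, pd j (pd j φ) x = φ y := by
  have hn' : (3 : ℝ) ≤ n := by exact_mod_cast hn
  have hω := sphereArea_pos n (by omega)
  have h := integral_norm_rpow_mul_laplacian hn (φ := fun x => φ (x + y))
    (hφ.comp (contDiff_id.add contDiff_const)) (hc.comp_homeomorph (Homeomorph.addRight y))
  simp only [pd_comp_add_right, zero_add] at h
  rw [← integral_add_right_eq_self _ y]
  have h2 (x : EuclideanSpace ℝ (Fin n)) :
      poissonK n (x + y - y) * ∑ j, pd j (pd j φ) (x + y)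
        = (((2 : ℝ) - n) * sphereArea n)⁻¹ *
          (‖x‖ ^ ((2 : ℝ) - n) * ∑ j, pd j (pd j φ) (x + y)) := by
    rw [add_sub_cancel_right, poissonK]
    ring
  simp only [h2]
  rw [integral_const_mul, h, ← mul_assoc ((2 : ℝ) - n), ← mul_assoc,
    inv_mul_cancel₀ (mul_ne_zero (by linarith) hω.ne'), one_mul]

end FundamentalSolution

section Potential

variable {n : ℕ}

/-- A kernel that is integrable near the origin and bounded away from it gives an absolutely
convergent potential when tested against bounded integrable functions. -/
theorem integrable_prod_kernel_mul {k f h : EuclideanSpace ℝ (Fin n) → ℝ} {B C : ℝ}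
    (hk : Measurable k) (hk1 : IntegrableOn k (Metric.ball 0 1))
    (hk2 : ∀ x ∉ Metric.ball 0 1, ‖k x‖ ≤ B) (hf : Integrable f) (hh : Integrable h)
    (hC : ∀ x, ‖h x‖ ≤ C) :
    Integrable (fun p : EuclideanSpace ℝ (Fin n) × EuclideanSpace ℝ (Fin n) =>
      k (p.1 - p.2) * f p.2 * h p.1) (volume.prod volume) := by
  set s : Set (EuclideanSpace ℝ (Fin n)) := Metric.ball 0 1
  have hs : MeasurableSet s := measurableSet_ball
  have hsub : Measurable fun p : EuclideanSpace ℝ (Fin n) × EuclideanSpace ℝ (Fin n) =>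
    p.1 - p.2 := measurable_sub
  have near : Integrable (fun p : EuclideanSpace ℝ (Fin n) × EuclideanSpace ℝ (Fin n) =>
      s.indicator k (p.1 - p.2) * f p.2 * h p.1) (volume.prod volume) := by
    have h1 := hf.convolution_integrand (ContinuousLinearMap.mul ℝ ℝ)
      ((integrable_indicator_iff hs).2 hk1)
    refine (h1.mul_bdd (c := C) hh.aestronglyMeasurable.comp_fst
      (Eventually.of_forall fun p => hC p.1)).congr (Eventually.of_forall fun p => ?_)
    simp [mul_comm]
  have far : Integrable (fun p : EuclideanSpace ℝ (Fin n) × EuclideanSpace ℝ (Fin n) =>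
      sᶜ.indicator k (p.1 - p.2) * (h p.1 * f p.2)) (volume.prod volume) := by
    refine (hh.mul_prod hf).bdd_mul (c := max B 0)
      ((hk.indicator hs.compl).comp hsub).aestronglyMeasurable
      (Eventually.of_forall fun p => ?_)
    by_cases hp : p.1 - p.2 ∈ s
    · simp [hp]
    · simpa [hp] using Or.inl (hk2 _ hp)
  refine (near.add far).congr (Eventually.of_forall fun p => ?_)
  have h3 : k (p.1 - p.2) = s.indicator k (p.1 - p.2) + sᶜ.indicator k (p.1 - p.2) :=
    (congrFun (Set.indicator_self_add_compl s k) _).symm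
  simp only [Pi.add_apply, h3]
  ring

theorem integrable_prod_poissonK_mul (hn : 3 ≤ n) {f h : EuclideanSpace ℝ (Fin n) → ℝ} {C : ℝ}
    (hf : Integrable f) (hh : Integrable h) (hC : ∀ x, ‖h x‖ ≤ C) :
    Integrable (fun p : EuclideanSpace ℝ (Fin n) × EuclideanSpace ℝ (Fin n) =>
      poissonK n (p.1 - p.2) * f p.2 * h p.1) (volume.prod volume) := by
  have hn' : (3 : ℝ) ≤ n := by exact_mod_cast hn
  refine integrable_prod_kernel_mul (B := 1 / ‖((2 : ℝ) - n) * sphereArea n‖)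
    measurable_poissonK ?_ (fun x hx => ?_) hf hh hC
  · exact (((locallyIntegrable_norm_rpow_two_sub (n := n) (by omega)).integrableOn_isCompact
      (isCompact_closedBall 0 1)).mono_set Metric.ball_subset_closedBall).div_const _
  · have hx1 : 1 ≤ ‖x‖ := by simpa using hx
    rw [poissonK, norm_div, Real.norm_of_nonneg (by positivity)]
    gcongr
    exact Real.rpow_le_one_of_one_le_of_nonpos hx1 (by linarith)

theorem integrable_prod_poissonK_mul_indicator_ball (hn : 3 ≤ n)
    {f : EuclideanSpace ℝ (Fin n) → ℝ} (hf : Integrable f) (R : ℝ) :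
    Integrable (fun p : EuclideanSpace ℝ (Fin n) × EuclideanSpace ℝ (Fin n) =>
      poissonK n (p.1 - p.2) * f p.2 * (Metric.ball 0 R).indicator (fun _ => (1 : ℝ)) p.1)
      (volume.prod volume) :=
  integrable_prod_poissonK_mul (C := 1) hn hf
    ((integrable_indicator_iff measurableSet_ball).2
      (integrableOn_const measure_ball_lt_top.ne))
    (fun x => (norm_indicator_le_norm_self _ x).trans (by simp))

end Potential

/-- for `f ∈ L¹(ℝⁿ)` (`n ≥ 3`), the Newtonian potential
`u(x) = ∫ K_n(x−y) f(y) dy` is defined for a.e. `x`, is locally integrable, and solves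
`Δu = f` in the sense of distributions. -/
theorem newtonian_potential_solves_poisson
    (n : ℕ) (hn : 3 ≤ n) (f : EuclideanSpace ℝ (Fin n) → ℝ)
    (hf : Integrable f volume) :
    (∀ᵐ x : EuclideanSpace ℝ (Fin n) ∂volume,
      Integrable (fun y => poissonK n (x - y) * f y) volume) ∧
    LocallyIntegrable (fun x : EuclideanSpace ℝ (Fin n) =>
      ∫ y, poissonK n (x - y) * f y) volume ∧
    ∀ φ : EuclideanSpace ℝ (Fin n) → ℝ, ContDiff ℝ (⊤ : ℕ∞) φ → HasCompactSupport φ →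
      ∫ x, (∫ y, poissonK n (x - y) * f y) * (∑ j, pd j (pd j φ) x)
        = ∫ x, f x * φ x := by
  refine ⟨?_, ?_, fun φ hφ hc => ?_⟩
  · have h (N : ℕ) := (integrable_prod_poissonK_mul_indicator_ball hn hf N).prod_right_ae
    filter_upwards [ae_all_iff.2 h] with x hx
    obtain ⟨N, hN⟩ := exists_nat_gt ‖x‖
    simpa [hN] using hx N
  · rw [locallyIntegrable_iff]
    intro K hK
    obtain ⟨R, -, hR⟩ := hK.isBounded.exists_pos_norm_lt
    refine IntegrableOn.mono_set (t := Metric.ball 0 R) ?_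
      (fun x hx => mem_ball_zero_iff.2 (hR x hx))
    rw [← integrable_indicator_iff measurableSet_ball]
    refine (integrable_prod_poissonK_mul_indicator_ball hn hf R).integral_prod_left.congr
      (Eventually.of_forall fun x => ?_)
    by_cases hx : x ∈ Metric.ball (0 : EuclideanSpace ℝ (Fin n)) R
    · simp only [Set.indicator_of_mem hx, mul_one]
    · simp only [Set.indicator_of_notMem hx, mul_zero, integral_zero]
  · have hΔ := (contDiff_laplacian hφ).continuous
    have hΔc := hasCompactSupport_laplacian hc
    obtain ⟨C, hC⟩ := hΔ.bounded_above_of_compact_support hΔc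
    have h := integrable_prod_poissonK_mul hn hf (hΔ.integrable_of_hasCompactSupport hΔc) hC
    simp only [← integral_mul_const]
    rw [integral_integral_swap h]
    congr 1
    ext y
    rw [← integral_poissonK_sub_mul_laplacian hn hφ hc y, ← integral_const_mul]
    congr 1
    ext x
    ring
end
end

section
/- Let n ≥ 1 and k ≥ 0 be integers, let α ∈ (0,1), and let Ω ⊆ ℝⁿ be open. Suppose f : Ω → ℝ is k times continuously differentiable and all its partial derivatives of order k are locally α-Hölder continuous on Ω, and suppose u is a locally integrable function on Ω which is a distributional solution of Δu = f on Ω, i.e. ∫_Ω u(x) Δφ(x) dx = ∫_Ω f(x) φ(x) dx for every smooth φ compactly supported in Ω. Then u has a representative (equal to u almost everywhere) which is (k+2) times continuously differentiable on Ω and whose partial derivatives of order k+2 are locally α-Hölder continuous on Ω. -/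
open MeasureTheory Set Filter Topology

noncomputable section

/-- Iterated spatial partial derivative along a list of coordinate directions
(a spatial multi-index). -/
noncomputable def pdIter {n : ℕ} : List (Fin n) →
    (EuclideanSpace ℝ (Fin n) → ℝ) → EuclideanSpace ℝ (Fin n) → ℝ
  | [], f => f
  | j :: l, f => pd j (pdIter l f)

/-- `g` is locally `α`-Hölder continuous on `Ω`. -/
def LocallyHolderOn {n : ℕ} (α : ℝ) (g : EuclideanSpace ℝ (Fin n) → ℝ)
    (Ω : Set (EuclideanSpace ℝ (Fin n))) : Prop :=
  ∀ x ∈ Ω, ∃ U ∈ nhds x, ∃ C : ℝ,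
    ∀ y ∈ U ∩ Ω, ∀ z ∈ U ∩ Ω, |g y - g z| ≤ C * ‖y - z‖ ^ α

section Regularity

local notation "𝔼" n:max => EuclideanSpace ℝ (Fin n)

variable {n : ℕ} {α : ℝ}

/-! ### Hölder classes -/

lemma pdIter_append_singleton (l : List (Fin n)) (j : Fin n) (f : 𝔼 n → ℝ) :
    pdIter (l ++ [j]) f = pdIter l (pd j f) := by
  induction l with
  | nil => rfl
  | cons i l ih => simp only [List.cons_append, pdIter, ih]

namespace LocallyHolderOn

variable {f g : 𝔼 n → ℝ} {Ω V : Set (𝔼 n)}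

lemma congr (hf : LocallyHolderOn α f Ω) (h : EqOn f g Ω) : LocallyHolderOn α g Ω := by
  intro x hx
  obtain ⟨U, hU, C, hC⟩ := hf x hx
  exact ⟨U, hU, C, fun y hy z hz => by rw [← h hy.2, ← h hz.2]; exact hC y hy z hz⟩

lemma mono (hf : LocallyHolderOn α f Ω) (h : V ⊆ Ω) : LocallyHolderOn α f V := by
  intro x hx
  obtain ⟨U, hU, C, hC⟩ := hf x (h hx)
  exact ⟨U, hU, C, fun y hy z hz => hC y ⟨hy.1, h hy.2⟩ z ⟨hz.1, h hz.2⟩⟩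

lemma of_locally (h : ∀ x ∈ Ω, ∃ V ∈ 𝓝 x, LocallyHolderOn α f V) : LocallyHolderOn α f Ω := by
  intro x hx
  obtain ⟨V, hV, hf⟩ := h x hx
  obtain ⟨U, hU, C, hC⟩ := hf x (mem_of_mem_nhds hV)
  exact ⟨U ∩ V, inter_mem hU hV, C, fun y hy z hz => hC y hy.1 z hz.1⟩

lemma add (hf : LocallyHolderOn α f Ω) (hg : LocallyHolderOn α g Ω) :
    LocallyHolderOn α (fun x => f x + g x) Ω := by
  intro x hx
  obtain ⟨U, hU, C, hC⟩ := hf x hx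
  obtain ⟨V, hV, D, hD⟩ := hg x hx
  refine ⟨U ∩ V, inter_mem hU hV, C + D, fun y hy z hz => ?_⟩
  have h1 := hC y ⟨hy.1.1, hy.2⟩ z ⟨hz.1.1, hz.2⟩
  have h2 := hD y ⟨hy.1.2, hy.2⟩ z ⟨hz.1.2, hz.2⟩
  calc |f y + g y - (f z + g z)| = |(f y - f z) + (g y - g z)| := by ring_nf
    _ ≤ |f y - f z| + |g y - g z| := abs_add_le _ _
    _ ≤ _ := by linarith

lemma continuousOn (hα : 0 < α) (hf : LocallyHolderOn α f Ω) : ContinuousOn f Ω := by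
  intro x hx
  obtain ⟨U, hU, C, hC⟩ := hf x hx
  rw [ContinuousWithinAt, tendsto_iff_norm_sub_tendsto_zero]
  have hlim : Tendsto (fun y => C * ‖y - x‖ ^ α) (𝓝[Ω] x) (𝓝 0) := by
    have : Continuous fun y : 𝔼 n => C * ‖y - x‖ ^ α :=
      continuous_const.mul ((continuous_id.sub continuous_const).norm.rpow_const
        fun _ => Or.inr hα.le)
    simpa [Real.zero_rpow hα.ne'] using this.continuousWithinAt.tendsto (s := Ω) (x := x)
  refine squeeze_zero' (Eventually.of_forall fun _ => norm_nonneg _) ?_ hlim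
  filter_upwards [mem_nhdsWithin_of_mem_nhds hU, self_mem_nhdsWithin] with y hy hy'
  exact hC y ⟨hy, hy'⟩ x ⟨mem_of_mem_nhds hU, hx⟩

lemma mul (hα : 0 < α) (hf : LocallyHolderOn α f Ω) (hg : LocallyHolderOn α g Ω) :
    LocallyHolderOn α (fun x => f x * g x) Ω := by
  have bdd : ∀ {h : 𝔼 n → ℝ}, LocallyHolderOn α h Ω → ∀ x ∈ Ω, ∃ U ∈ 𝓝 x, ∀ y ∈ U ∩ Ω,
      |h y| ≤ |h x| + 1 := by
    intro h hh x hx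
    have := ((hh.continuousOn hα x hx).abs).eventually (gt_mem_nhds (lt_add_one |h x|))
    obtain ⟨U, hU, hU'⟩ := mem_nhdsWithin_iff_exists_mem_nhds_inter.1 this
    exact ⟨U, hU, fun y hy => (hU' hy).le⟩
  intro x hx
  obtain ⟨U, hU, C, hC⟩ := hf x hx
  obtain ⟨V, hV, D, hD⟩ := hg x hx
  obtain ⟨U', hU', hC'⟩ := bdd hf x hx
  obtain ⟨V', hV', hD'⟩ := bdd hg x hx
  refine ⟨(U ∩ V) ∩ (U' ∩ V'), inter_mem (inter_mem hU hV) (inter_mem hU' hV'),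
    (|g x| + 1) * C + (|f x| + 1) * D, fun y hy z hz => ?_⟩
  have h1 := hC y ⟨hy.1.1.1, hy.2⟩ z ⟨hz.1.1.1, hz.2⟩
  have h2 := hD y ⟨hy.1.1.2, hy.2⟩ z ⟨hz.1.1.2, hz.2⟩
  have h3 := hC' z ⟨hz.1.2.1, hz.2⟩
  have h4 := hD' y ⟨hy.1.2.2, hy.2⟩
  calc |f y * g y - f z * g z| = |g y * (f y - f z) + f z * (g y - g z)| := by ring_nf
    _ ≤ |g y * (f y - f z)| + |f z * (g y - g z)| := abs_add_le _ _
    _ = |g y| * |f y - f z| + |f z| * |g y - g z| := by rw [abs_mul, abs_mul]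
    _ ≤ (|g x| + 1) * (C * ‖y - z‖ ^ α) + (|f x| + 1) * (D * ‖y - z‖ ^ α) := by gcongr
    _ = _ := by ring

lemma of_contDiffOn (hα : α ≤ 1) (hΩ : IsOpen Ω) (hf : ContDiffOn ℝ 1 f Ω) :
    LocallyHolderOn α f Ω := by
  intro x hx
  obtain ⟨K, t, ht, hK⟩ := (hf.contDiffAt (hΩ.mem_nhds hx)).exists_lipschitzOnWith
  refine ⟨t ∩ Metric.ball x (1 / 2), inter_mem ht (Metric.ball_mem_nhds x (by norm_num)), K,
    fun y hy z hz => ?_⟩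
  have h1 := hK.dist_le_mul y hy.1.1 z hz.1.1
  rw [Real.dist_eq, dist_eq_norm] at h1
  have h2 : ‖y - z‖ ≤ 1 := by
    rw [← dist_eq_norm]
    have := dist_triangle_right y z x
    have := Metric.mem_ball.1 hy.1.2
    have := Metric.mem_ball.1 hz.1.2
    linarith
  refine h1.trans (mul_le_mul_of_nonneg_left ?_ K.2)
  rcases (norm_nonneg (y - z)).eq_or_lt with h0 | h0
  · rw [← h0]; exact Real.rpow_nonneg le_rfl _
  · simpa using Real.rpow_le_rpow_of_exponent_ge h0 h2 hα

end LocallyHolderOn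

/-- The functions of class `C^k` on `Ω` all of whose partial derivatives of order `k` are locally
`α`-Hölder continuous, described recursively. -/
def HolderClass (α : ℝ) (Ω : Set (𝔼 n)) : ℕ → (𝔼 n → ℝ) → Prop
  | 0, f => LocallyHolderOn α f Ω
  | k + 1, f => DifferentiableOn ℝ f Ω ∧ ∀ j, HolderClass α Ω k (pd j f)

lemma fderiv_eq_sum_pd (f : 𝔼 n → ℝ) (x : 𝔼 n) :
    fderiv ℝ f x = ∑ j, pd j f x • (EuclideanSpace.proj j : 𝔼 n →L[ℝ] ℝ) := by
  ext v
  conv_lhs => rw [← (EuclideanSpace.basisFun (Fin n) ℝ).sum_repr v]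
  simp [pd, mul_comm]

lemma contDiffOn_succ_of_pd {f : 𝔼 n → ℝ} {Ω : Set (𝔼 n)} {k : ℕ} (hΩ : IsOpen Ω)
    (hf : DifferentiableOn ℝ f Ω) (h : ∀ j, ContDiffOn ℝ k (pd j f) Ω) :
    ContDiffOn ℝ (k + 1 : ℕ) f Ω := by
  rw [Nat.cast_add, Nat.cast_one, contDiffOn_succ_iff_fderiv_of_isOpen hΩ]
  refine ⟨hf, by simp, ?_⟩
  rw [funext (fderiv_eq_sum_pd f)]
  exact ContDiffOn.sum fun j _ => (h j).smul contDiffOn_const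

lemma ContDiffOn.pd {f : 𝔼 n → ℝ} {Ω : Set (𝔼 n)} {k : ℕ} (hΩ : IsOpen Ω)
    (hf : ContDiffOn ℝ (k + 1 : ℕ) f Ω) (j : Fin n) : ContDiffOn ℝ k (pd j f) Ω :=
  (hf.fderiv_of_isOpen hΩ (by norm_cast)).clm_apply contDiffOn_const

namespace HolderClass

variable {f g : 𝔼 n → ℝ} {Ω V : Set (𝔼 n)} {k : ℕ}

lemma iff_pdIter (hα : 0 < α) (hΩ : IsOpen Ω) : HolderClass α Ω k f ↔
    ContDiffOn ℝ k f Ω ∧ ∀ l : List (Fin n), l.length = k → LocallyHolderOn α (pdIter l f) Ω := by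
  induction k generalizing f with
  | zero =>
    simp only [HolderClass, CharP.cast_eq_zero, contDiffOn_zero, List.length_eq_zero_iff,
      forall_eq, pdIter]
    exact ⟨fun h => ⟨h.continuousOn hα, h⟩, fun h => h.2⟩
  | succ k ih =>
    simp only [HolderClass, ih]
    constructor
    · rintro ⟨hd, h⟩
      refine ⟨contDiffOn_succ_of_pd hΩ hd fun j => (h j).1, fun l hl => ?_⟩
      obtain ⟨l, j, rfl⟩ := (List.eq_nil_or_concat' l).resolve_left
        (List.ne_nil_of_length_eq_add_one hl)
      rw [pdIter_append_singleton]
      exact (h j).2 l (by simpa using hl)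
    · rintro ⟨hc, h⟩
      refine ⟨hc.differentiableOn (by simp), fun j => ⟨hc.pd hΩ j, fun l hl => ?_⟩⟩
      rw [← pdIter_append_singleton]
      exact h _ (by simpa using hl)

lemma of_contDiff (hα : α ∈ Ioo (0 : ℝ) 1) (hf : ContDiff ℝ (⊤ : ℕ∞) f) (hΩ : IsOpen Ω) :
    HolderClass α Ω k f := by
  induction k generalizing f with
  | zero =>
    exact LocallyHolderOn.of_contDiffOn hα.2.le hΩ
      (hf.of_le (by exact_mod_cast le_top)).contDiffOn
  | succ k ih =>
    refine ⟨(hf.differentiable (by simp)).differentiableOn, fun j => ih ?_⟩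
    exact (hf.fderiv_right (by simp)).clm_apply contDiff_const

lemma mono (hf : HolderClass α Ω k f) (h : V ⊆ Ω) : HolderClass α V k f := by
  induction k generalizing f with
  | zero => exact LocallyHolderOn.mono hf h
  | succ k ih => exact ⟨hf.1.mono h, fun j => ih (hf.2 j)⟩

lemma congr (hΩ : IsOpen Ω) (hf : HolderClass α Ω k f) (h : EqOn f g Ω) :
    HolderClass α Ω k g := by
  induction k generalizing f g with
  | zero => exact LocallyHolderOn.congr hf h
  | succ k ih =>
    refine ⟨hf.1.congr fun x hx => (h hx).symm, fun j => ih (hf.2 j) fun x hx => ?_⟩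
    simp only [pd]
    rw [(h.eventuallyEq_of_mem (hΩ.mem_nhds hx)).fderiv_eq]

lemma of_locally (h : ∀ x ∈ Ω, ∃ V ∈ 𝓝 x, HolderClass α V k f) : HolderClass α Ω k f := by
  induction k generalizing f with
  | zero => exact LocallyHolderOn.of_locally h
  | succ k ih =>
    refine ⟨fun x hx => ?_, fun j => ih fun x hx => ?_⟩
    · obtain ⟨V, hV, hf⟩ := h x hx
      exact (hf.1.differentiableAt hV).differentiableWithinAt
    · obtain ⟨V, hV, hf⟩ := h x hx
      exact ⟨V, hV, hf.2 j⟩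

lemma of_succ (hα : α ∈ Ioo (0 : ℝ) 1) (hΩ : IsOpen Ω) (hf : HolderClass α Ω (k + 1) f) :
    HolderClass α Ω k f := by
  induction k generalizing f with
  | zero =>
    exact LocallyHolderOn.of_contDiffOn hα.2.le hΩ
      (by simpa using ((iff_pdIter hα.1 hΩ).1 hf).1)
  | succ k ih => exact ⟨hf.1, fun j => ih (hf.2 j)⟩

lemma add (hΩ : IsOpen Ω) (hf : HolderClass α Ω k f) (hg : HolderClass α Ω k g) :
    HolderClass α Ω k fun x => f x + g x := by
  induction k generalizing f g with
  | zero => exact LocallyHolderOn.add hf hg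
  | succ k ih =>
    refine ⟨hf.1.add hg.1, fun j => (ih (hf.2 j) (hg.2 j)).congr hΩ fun x hx => ?_⟩
    simp only [pd]
    rw [fderiv_fun_add (hf.1.differentiableAt (hΩ.mem_nhds hx))
      (hg.1.differentiableAt (hΩ.mem_nhds hx))]
    rfl

lemma mul (hα : α ∈ Ioo (0 : ℝ) 1) (hΩ : IsOpen Ω) (hf : HolderClass α Ω k f)
    (hg : HolderClass α Ω k g) : HolderClass α Ω k fun x => f x * g x := by
  induction k generalizing f g with
  | zero => exact LocallyHolderOn.mul hα.1 hf hg
  | succ k ih =>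
    refine ⟨hf.1.mul hg.1, fun j => ((ih (hf.of_succ hα hΩ) (hg.2 j)).add hΩ
      (ih (hf.2 j) (hg.of_succ hα hΩ))).congr hΩ fun x hx => ?_⟩
    simp only [pd]
    rw [fderiv_fun_mul (hf.1.differentiableAt (hΩ.mem_nhds hx))
      (hg.1.differentiableAt (hΩ.mem_nhds hx))]
    simp [mul_comm]

end HolderClass

/-! ### Convolution at scale `t` -/

/-- The convolution of `f` with the rescaled kernel `t⁻ⁿ Φ(·/t)`. -/
def scaledConv (t : ℝ) (Φ f : 𝔼 n → ℝ) (x : 𝔼 n) : ℝ :=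
  ∫ y, f (x - t • y) * Φ y

section ScaledConv

variable {t : ℝ} {Φ f : 𝔼 n → ℝ}

open scoped Convolution

lemma scaledConv_eq_convolution (ht : 0 < t) (Φ f : 𝔼 n → ℝ) :
    scaledConv t Φ f = fun x => (t ^ n)⁻¹ *
      (f ⋆[ContinuousLinearMap.mul ℝ ℝ, volume] fun y => Φ (t⁻¹ • y)) x := by
  ext x
  have h := Measure.integral_comp_inv_smul_of_nonneg (volume : Measure (𝔼 n))
    (fun y => f (x - t • y) * Φ y) ht.le
  rw [convolution_eq_swap]
  simp only [ContinuousLinearMap.mul_apply']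
  simp only [smul_inv_smul₀ ht.ne', finrank_euclideanSpace, Fintype.card_fin, smul_eq_mul] at h
  rw [h, scaledConv, inv_mul_cancel_left₀ (pow_pos ht n).ne']

lemma HasCompactSupport.comp_inv_smul (hc : HasCompactSupport Φ) (ht : 0 < t) :
    HasCompactSupport fun y => Φ (t⁻¹ • y) :=
  hc.comp_smul (inv_ne_zero ht.ne')

lemma ContDiff.comp_const_smul {k : WithTop ℕ∞} (hΦ : ContDiff ℝ k Φ) (s : ℝ) :
    ContDiff ℝ k fun y => Φ (s • y) :=
  hΦ.comp (contDiff_const_smul s)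

lemma contDiff_scaledConv (ht : 0 < t) (hΦ : ContDiff ℝ (⊤ : ℕ∞) Φ) (hc : HasCompactSupport Φ)
    (hf : LocallyIntegrable f) : ContDiff ℝ (⊤ : ℕ∞) (scaledConv t Φ f) := by
  rw [scaledConv_eq_convolution ht]
  exact contDiff_const.mul ((hc.comp_inv_smul ht).contDiff_convolution_right _ hf
    (hΦ.comp_const_smul _))

lemma pd_scaledConv_kernel (ht : 0 < t) (hΦ : ContDiff ℝ (⊤ : ℕ∞) Φ) (hc : HasCompactSupport Φ)
    (hf : LocallyIntegrable f) (j : Fin n) :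
    pd j (scaledConv t Φ f) = fun x => t⁻¹ * scaledConv t (pd j Φ) f x := by
  ext x
  have h := ((hc.comp_inv_smul ht).hasFDerivAt_convolution_right (ContinuousLinearMap.mul ℝ ℝ) hf
    ((hΦ.comp_const_smul t⁻¹).of_le (by exact_mod_cast le_top)) x).const_mul (t ^ n)⁻¹
  rw [scaledConv_eq_convolution ht, scaledConv_eq_convolution ht, pd, h.fderiv]
  have h2 : (fun a => (fderiv ℝ (fun y => Φ (t⁻¹ • y)) a) (EuclideanSpace.single j 1)) =
      t⁻¹ • fun a => pd j Φ (t⁻¹ • a) := by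
    ext a
    simp [pd, fderiv_comp_smul]
  rw [smul_apply, convolution_precompR_apply _ hf
    ((hc.comp_inv_smul ht).fderiv ℝ)
    ((hΦ.comp_const_smul t⁻¹).continuous_fderiv (by simp)), h2, convolution_smul]
  simp only [Pi.smul_apply, smul_eq_mul]
  ring

lemma pd_scaledConv_apply (ht : 0 < t) (hΦ : Continuous Φ)
    (hf : ContDiff ℝ 1 f) (hfc : HasCompactSupport f) (j : Fin n) :
    Differentiable ℝ (scaledConv t Φ f) ∧
    pd j (scaledConv t Φ f) = scaledConv t Φ (pd j f) := by
  have hΦ' : LocallyIntegrable fun y => Φ (t⁻¹ • y) :=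
    (hΦ.comp (continuous_const_smul _)).locallyIntegrable
  have h := fun x => (hfc.hasFDerivAt_convolution_left (ContinuousLinearMap.mul ℝ ℝ) hf
    hΦ' x).const_mul (t ^ n)⁻¹
  constructor
  · rw [scaledConv_eq_convolution ht]
    exact fun x => (h x).differentiableAt
  · ext x
    rw [scaledConv_eq_convolution ht, scaledConv_eq_convolution ht, pd, (h x).fderiv]
    have hex := (hfc.fderiv ℝ).convolutionExists_left
      ((ContinuousLinearMap.mul ℝ ℝ).precompL (𝔼 n)) (hf.continuous_fderiv (by simp)) hΦ' x
    rw [smul_apply, convolution_def, ContinuousLinearMap.integral_apply hex]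
    rfl

lemma abs_scaledConv_le {M : ℝ} (hΦ : Continuous Φ) (hc : HasCompactSupport Φ)
    (hM : ∀ x, |f x| ≤ M) (x : 𝔼 n) : |scaledConv t Φ f x| ≤ M * ∫ y, |Φ y| := by
  rw [← integral_const_mul, scaledConv, ← Real.norm_eq_abs]
  refine norm_integral_le_of_norm_le
    ((hΦ.integrable_of_hasCompactSupport hc).abs.const_mul M) (Eventually.of_forall fun y => ?_)
  rw [norm_mul]
  exact mul_le_mul_of_nonneg_right (hM _) (norm_nonneg _)

lemma abs_scaledConv_le_of_holder {C : ℝ} (hα : 0 < α) (ht : 0 < t) (hΦ : Continuous Φ)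
    (hs : ∀ y, 1 < ‖y‖ → Φ y = 0)
    (h0 : ∫ y, Φ y = 0) (hf : Continuous f) (hC : ∀ x y, |f x - f y| ≤ C * ‖x - y‖ ^ α)
    (hC0 : 0 ≤ C) (x : 𝔼 n) : |scaledConv t Φ f x| ≤ C * t ^ α * ∫ y, |Φ y| := by
  have hc : HasCompactSupport Φ := HasCompactSupport.intro (isCompact_closedBall (0 : 𝔼 n) 1)
    fun y hy => hs y (by simpa using hy)
  have hfint : Integrable fun y => f (x - t • y) * Φ y :=
    Continuous.integrable_of_hasCompactSupport (by fun_prop) hc.mul_left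
  have hfint' : Integrable fun y => f x * Φ y :=
    (hΦ.integrable_of_hasCompactSupport hc).const_mul _
  have : scaledConv t Φ f x = ∫ y, (f (x - t • y) - f x) * Φ y := by
    simp_rw [sub_mul]
    rw [integral_sub hfint hfint', integral_const_mul, h0, mul_zero, sub_zero, scaledConv]
  rw [this, ← integral_const_mul, ← Real.norm_eq_abs]
  refine norm_integral_le_of_norm_le
    ((hΦ.integrable_of_hasCompactSupport hc).abs.const_mul _) (Eventually.of_forall fun y => ?_)
  rw [norm_mul]
  by_cases hy : 1 < ‖y‖
  · simp [hs y hy]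
  refine mul_le_mul_of_nonneg_right ((hC _ _).trans ?_) (norm_nonneg _)
  refine mul_le_mul_of_nonneg_left (Real.rpow_le_rpow (norm_nonneg _) ?_ hα.le) hC0
  rw [sub_sub_cancel_left, norm_neg, norm_smul, Real.norm_of_nonneg ht.le]
  exact mul_le_of_le_one_right ht.le (not_lt.1 hy)

lemma integral_pd_eq_zero (hΦ : ContDiff ℝ (⊤ : ℕ∞) Φ) (hc : HasCompactSupport Φ) (j : Fin n) :
    ∫ y, pd j Φ y = 0 := by
  have h := congrFun (pd_scaledConv_kernel (f := fun _ => 1) one_pos hΦ hc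
    continuous_const.locallyIntegrable j) 0
  have h2 : scaledConv 1 Φ (fun _ => 1) = fun _ => ∫ y, Φ y := by
    ext x
    simp [scaledConv]
  rw [h2] at h
  simpa [pd, scaledConv] using h.symm

end ScaledConv

/-! ### Series of functions -/

lemma norm_fderiv_le_of_pd {f : 𝔼 n → ℝ} {x : 𝔼 n} {b : ℝ} (h : ∀ j, |pd j f x| ≤ b) :
    ‖fderiv ℝ f x‖ ≤ n * b := by
  rw [fderiv_eq_sum_pd]
  have : ∀ j, ‖pd j f x • (EuclideanSpace.proj j : 𝔼 n →L[ℝ] ℝ)‖ ≤ b := fun j => by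
    refine ContinuousLinearMap.opNorm_le_bound _ ((abs_nonneg _).trans (h j)) fun v => ?_
    rw [smul_apply, norm_smul]
    exact mul_le_mul (h j) (PiLp.norm_apply_le v j) (norm_nonneg _) ((abs_nonneg _).trans (h j))
  simpa using norm_sum_le_of_le Finset.univ fun j _ => this j

lemma differentiable_tsum_of_pd {w : ℕ → 𝔼 n → ℝ} {a b : ℕ → ℝ}
    (hw : ∀ m, Differentiable ℝ (w m)) (ha : Summable a) (hb : Summable b)
    (hwa : ∀ m x, |w m x| ≤ a m) (hwb : ∀ j m x, |pd j (w m) x| ≤ b m) :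
    Differentiable ℝ (fun x => ∑' m, w m x) ∧
      ∀ j, pd j (fun x => ∑' m, w m x) = fun x => ∑' m, pd j (w m) x := by
  have hb' : Summable fun m => n * b m := hb.mul_left _
  have hbd : ∀ m x, ‖fderiv ℝ (w m) x‖ ≤ n * b m := fun m x =>
    norm_fderiv_le_of_pd fun j => hwb j m x
  have hs : ∀ x, Summable fun m => w m x := fun x => ha.of_norm_bounded fun m => hwa m x
  refine ⟨differentiable_tsum hb' (fun m x => (hw m x).hasFDerivAt) hbd, fun j => ?_⟩
  ext x
  have hsd : Summable fun m => fderiv ℝ (w m) x := hb'.of_norm_bounded fun m => hbd m x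
  rw [pd, fderiv_tsum_apply hb' hw hbd (hs 0) x]
  exact (ContinuousLinearMap.apply ℝ ℝ (EuclideanSpace.single j (1 : ℝ))).map_tsum hsd

lemma sum_geometric_le {r : ℝ} (h0 : 0 ≤ r) (h1 : r < 1) (N : ℕ) :
    ∑ i ∈ Finset.range N, r ^ i ≤ (1 - r)⁻¹ := by
  rw [← tsum_geometric_of_lt_one h0 h1]
  exact (summable_geometric_of_lt_one h0 h1).sum_le_tsum _ fun i _ => pow_nonneg h0 i

lemma half_rpow_mem {β : ℝ} (hβ : 0 < β) : (1 / 2 : ℝ) ^ β ∈ Ioo (0 : ℝ) 1 :=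
  ⟨by positivity, Real.rpow_lt_one (by norm_num) (by norm_num) hβ⟩

lemma mul_half_pow_rpow {t β : ℝ} (ht : 0 < t) (m : ℕ) :
    (t * (1 / 2) ^ m) ^ β = t ^ β * ((1 / 2 : ℝ) ^ β) ^ m := by
  rw [Real.mul_rpow ht.le (by positivity), ← Real.rpow_natCast, ← Real.rpow_natCast,
    ← Real.rpow_mul (by norm_num), ← Real.rpow_mul (by norm_num), mul_comm β]

lemma summable_mul_half_pow_rpow {t β : ℝ} (ht : 0 < t) (hβ : 0 < β) (C : ℝ) :
    Summable fun m : ℕ => C * (t * (1 / 2) ^ m) ^ β := by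
  simp_rw [mul_half_pow_rpow ht]
  exact ((summable_geometric_of_lt_one (half_rpow_mem hβ).1.le (half_rpow_mem hβ).2).mul_left
    _).mul_left _

/-- Summation over dyadic scales, split at the scale `d`. -/
lemma tsum_dyadic_le {A B t d : ℝ} {c : ℕ → ℝ} (hα : α ∈ Ioo (0 : ℝ) 1) (ht : 0 < t) (hd : 0 < d)
    (hA0 : 0 ≤ A) (hB0 : 0 ≤ B) (hc : ∀ m, 0 ≤ c m)
    (hA : ∀ m, c m ≤ A * (t * (1 / 2) ^ m) ^ α)
    (hB : ∀ m, c m ≤ B * (t * (1 / 2) ^ m) ^ (α - 1) * d) :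
    ∑' m, c m ≤ (A * (1 - (1 / 2) ^ α)⁻¹ + B * (1 - (1 / 2) ^ (1 - α))⁻¹) * d ^ α := by
  set r := (1 / 2 : ℝ) ^ α with hr
  set q := (1 / 2 : ℝ) ^ (1 - α) with hq
  obtain ⟨r0, r1⟩ : 0 < r ∧ r < 1 := half_rpow_mem hα.1
  obtain ⟨q0, q1⟩ : 0 < q ∧ q < 1 := half_rpow_mem (sub_pos.2 hα.2)
  have hcs : Summable c := (summable_mul_half_pow_rpow ht hα.1 A).of_nonneg_of_le hc hA
  have hgs : ∀ s : ℝ, Summable fun i : ℕ => A * s ^ α * r ^ i := fun s =>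
    (summable_geometric_of_lt_one r0.le r1).mul_left _
  have hr' : 0 ≤ (1 - r)⁻¹ := inv_nonneg.2 (by linarith)
  have hq' : 0 ≤ (1 - q)⁻¹ := inv_nonneg.2 (by linarith)
  rcases lt_or_ge t d with htd | htd
  · calc ∑' m, c m ≤ ∑' m, A * d ^ α * r ^ m := by
          refine hcs.tsum_le_tsum (fun m => (hA m).trans ?_) (hgs d)
          rw [mul_half_pow_rpow ht, ← mul_assoc]
          have := Real.rpow_le_rpow ht.le htd.le hα.1.le
          gcongr
      _ = A * (1 - r)⁻¹ * d ^ α := by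
          rw [tsum_mul_left, tsum_geometric_of_lt_one r0.le r1]; ring
      _ ≤ _ := by gcongr; exact le_add_of_nonneg_right (by positivity)
  · obtain ⟨M, hM1, hM2⟩ := exists_nat_pow_near_of_lt_one (div_pos hd ht)
      ((div_le_one ht).2 htd) (by norm_num : (0 : ℝ) < 1 / 2) (by norm_num)
    rw [lt_div_iff₀ ht, mul_comm] at hM1
    rw [div_le_iff₀ ht, mul_comm] at hM2
    rw [← hcs.sum_add_tsum_nat_add (M + 1)]
    have head : ∑ m ∈ Finset.range (M + 1), c m ≤ B * (1 - q)⁻¹ * d ^ α := by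
      calc ∑ m ∈ Finset.range (M + 1), c m
          ≤ ∑ m ∈ Finset.range (M + 1), B * d ^ α * q ^ (M + 1 - 1 - m) := by
            refine Finset.sum_le_sum fun m hm => (hB m).trans ?_
            have hm : m ≤ M := Nat.lt_succ_iff.1 (Finset.mem_range.1 hm)
            have e : t * (1 / 2 : ℝ) ^ M = t * (1 / 2) ^ m * (1 / 2) ^ (M - m) := by
              rw [mul_assoc, ← pow_add, Nat.add_sub_cancel' hm]
            have e2 : (t * (1 / 2 : ℝ) ^ M) ^ (α - 1) * q ^ (M - m) =
                (t * (1 / 2) ^ m) ^ (α - 1) := by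
              rw [e, mul_half_pow_rpow (by positivity), mul_assoc, ← mul_pow, hq,
                ← Real.rpow_add (by norm_num)]
              simp
            rw [← e2, Nat.add_sub_cancel]
            have h3 : (t * (1 / 2 : ℝ) ^ M) ^ (α - 1) ≤ d ^ (α - 1) :=
              Real.rpow_le_rpow_of_nonpos hd hM2 (by linarith [hα.2])
            calc B * ((t * (1 / 2 : ℝ) ^ M) ^ (α - 1) * q ^ (M - m)) * d
                ≤ B * (d ^ (α - 1) * q ^ (M - m)) * d := by gcongr
              _ = B * (d ^ (α - 1) * d) * q ^ (M - m) := by ring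
              _ = B * d ^ α * q ^ (M - m) := by
                rw [← Real.rpow_add_one hd.ne', sub_add_cancel]
        _ = B * d ^ α * ∑ i ∈ Finset.range (M + 1), q ^ i := by
            rw [← Finset.mul_sum, Finset.sum_range_reflect (fun i => q ^ i)]
        _ ≤ B * d ^ α * (1 - q)⁻¹ := by gcongr; exact sum_geometric_le q0.le q1 _
        _ = _ := by ring
    have tail : ∑' m, c (m + (M + 1)) ≤ A * (1 - r)⁻¹ * d ^ α := by
      calc ∑' m, c (m + (M + 1)) ≤ ∑' m, A * d ^ α * r ^ m := by
            refine ((summable_nat_add_iff (M + 1)).2 hcs).tsum_le_tsum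
              (fun m => (hA _).trans ?_) (hgs d)
            have e : t * (1 / 2 : ℝ) ^ (m + (M + 1)) = t * (1 / 2) ^ (M + 1) * (1 / 2) ^ m := by
              rw [mul_assoc, ← pow_add, add_comm m]
            rw [e, mul_half_pow_rpow (by positivity), ← mul_assoc]
            have := Real.rpow_le_rpow (by positivity) hM1.le hα.1.le
            gcongr
        _ = A * (1 - r)⁻¹ * d ^ α := by
            rw [tsum_mul_left, tsum_geometric_of_lt_one r0.le r1]; ring
    linarith

lemma exists_holder_tsum {w : ℕ → 𝔼 n → ℝ} {A B t : ℝ} (hα : α ∈ Ioo (0 : ℝ) 1) (ht : 0 < t)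
    (hw : ∀ m, Differentiable ℝ (w m)) (hA : ∀ m x, |w m x| ≤ A * (t * (1 / 2) ^ m) ^ α)
    (hB : ∀ j m x, |pd j (w m) x| ≤ B * (t * (1 / 2) ^ m) ^ (α - 1)) (hB0 : 0 ≤ B) :
    ∃ C, ∀ x y, |∑' m, w m x - ∑' m, w m y| ≤ C * ‖x - y‖ ^ α := by
  have hA0 : 0 ≤ A := by
    refine nonneg_of_mul_nonneg_left ((abs_nonneg _).trans (hA 0 0)) (by positivity)
  refine ⟨2 * A * (1 - (1 / 2) ^ α)⁻¹ + n * B * (1 - (1 / 2) ^ (1 - α))⁻¹, fun x y => ?_⟩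
  rcases eq_or_ne x y with rfl | hxy
  · simp [Real.zero_rpow hα.1.ne']
  have hs : ∀ x, Summable fun m => w m x := fun x =>
    (summable_mul_half_pow_rpow ht hα.1 A).of_norm_bounded fun m => hA m x
  have hd : 0 < ‖x - y‖ := norm_pos_iff.2 (sub_ne_zero.2 hxy)
  rw [← (hs x).tsum_sub (hs y)]
  have h1 : ∀ m, |w m x - w m y| ≤ 2 * A * (t * (1 / 2) ^ m) ^ α := fun m =>
    (abs_sub _ _).trans (by linarith [hA m x, hA m y])
  have h2 : ∀ m, |w m x - w m y| ≤ n * B * (t * (1 / 2) ^ m) ^ (α - 1) * ‖x - y‖ := fun m => by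
    rw [mul_assoc (n : ℝ)]
    exact convex_univ.norm_image_sub_le_of_norm_fderiv_le (𝕜 := ℝ) (f := w m)
      (fun z _ => hw m z) (fun z _ => norm_fderiv_le_of_pd fun j => hB j m z)
      (mem_univ y) (mem_univ x)
  have hsum : Summable fun m => |w m x - w m y| :=
    (summable_mul_half_pow_rpow ht hα.1 _).of_nonneg_of_le (fun _ => abs_nonneg _) h1
  have h3 : |∑' m, (w m x - w m y)| ≤ ∑' m, |w m x - w m y| := by
    simp_rw [← Real.norm_eq_abs] at hsum ⊢
    exact norm_tsum_le_tsum_norm hsum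
  exact h3.trans (tsum_dyadic_le hα ht hd (mul_nonneg zero_le_two hA0)
    (mul_nonneg n.cast_nonneg hB0) (fun _ => abs_nonneg _) h1 h2)

/-! ### The dyadic potential -/

lemma exists_holder_of_hasCompactSupport {f : 𝔼 n → ℝ} (hα : 0 < α)
    (hf : LocallyHolderOn α f univ) (hc : HasCompactSupport f) :
    ∃ C, 0 ≤ C ∧ ∀ x y, |f x - f y| ≤ C * ‖x - y‖ ^ α := by
  have hcont : Continuous f := by simpa using hf.continuousOn hα
  have near : ∃ δ > 0, ∃ C, 0 ≤ C ∧ ∀ x ∈ tsupport f, ∀ y, ‖x - y‖ < δ →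
      |f x - f y| ≤ C * ‖x - y‖ ^ α := by
    refine hc.isCompact.induction_on (p := fun s => ∃ δ > 0, ∃ C, 0 ≤ C ∧ ∀ x ∈ s, ∀ y,
      ‖x - y‖ < δ → |f x - f y| ≤ C * ‖x - y‖ ^ α) ⟨1, one_pos, 0, le_rfl, by simp⟩ ?_ ?_ ?_
    · rintro s t hst ⟨δ, hδ, C, hC, h⟩
      exact ⟨δ, hδ, C, hC, fun x hx => h x (hst hx)⟩
    · rintro s t ⟨δ, hδ, C, hC, h⟩ ⟨δ', hδ', C', hC', h'⟩
      refine ⟨min δ δ', lt_min hδ hδ', max C C', le_max_of_le_left hC, fun x hx y hxy => ?_⟩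
      have hpos : 0 ≤ ‖x - y‖ ^ α := by positivity
      rcases hx with hx | hx
      · exact (h x hx y (hxy.trans_le (min_le_left _ _))).trans
          (mul_le_mul_of_nonneg_right (le_max_left _ _) hpos)
      · exact (h' x hx y (hxy.trans_le (min_le_right _ _))).trans
          (mul_le_mul_of_nonneg_right (le_max_right _ _) hpos)
    · intro x _
      obtain ⟨U, hU, C, hC⟩ := hf x (mem_univ x)
      obtain ⟨ε, hε, hεU⟩ := Metric.mem_nhds_iff.1 hU
      refine ⟨Metric.ball x (ε / 2), mem_nhdsWithin_of_mem_nhds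
        (Metric.ball_mem_nhds x (half_pos hε)), ε / 2, half_pos hε, |C|, abs_nonneg _,
        fun y hy z hyz => ?_⟩
      have hy : dist y x < ε / 2 := hy
      have hz : dist z x < ε := by
        have := dist_triangle_left z x y
        rw [dist_eq_norm y z] at this
        linarith
      refine (hC y ⟨hεU (Metric.mem_ball.2 (by linarith)), trivial⟩ z
        ⟨hεU hz, trivial⟩).trans ?_
      gcongr
      exact le_abs_self C
  obtain ⟨δ, hδ, C, hC, h⟩ := near
  obtain ⟨M, hM⟩ := hcont.bounded_above_of_compact_support hc
  have hM0 : 0 ≤ M := (norm_nonneg _).trans (hM 0)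
  have hδ' : 0 < δ ^ α := by positivity
  refine ⟨C + 2 * M / δ ^ α, by positivity, fun x y => ?_⟩
  have hxy : 0 ≤ ‖x - y‖ ^ α := by positivity
  have hM' : 0 ≤ 2 * M / δ ^ α * ‖x - y‖ ^ α := by positivity
  have hC' : 0 ≤ C * ‖x - y‖ ^ α := by positivity
  rw [add_mul]
  rcases lt_or_ge ‖x - y‖ δ with hlt | hge
  · by_cases hx : x ∈ tsupport f
    · linarith [h x hx y hlt]
    by_cases hy : y ∈ tsupport f
    · have := h y hy x (by rwa [norm_sub_rev])
      rw [abs_sub_comm, norm_sub_rev] at this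
      linarith
    · rw [image_eq_zero_of_notMem_tsupport hx, image_eq_zero_of_notMem_tsupport hy]
      simp only [sub_self, abs_zero]
      linarith
  · have h1 : |f x - f y| ≤ 2 * M := (abs_sub _ _).trans (by
      have h2 := hM x
      have h3 := hM y
      rw [Real.norm_eq_abs] at h2 h3
      linarith)
    have h2 : 2 * M ≤ 2 * M / δ ^ α * ‖x - y‖ ^ α := by
      rw [div_mul_eq_mul_div, le_div_iff₀ hδ']
      gcongr
    linarith

lemma exists_integral_pd_le (Φ : 𝔼 n → ℝ) :
    ∃ B, 0 ≤ B ∧ (∫ y, |Φ y| ≤ B) ∧ ∀ j, ∫ y, |pd j Φ y| ≤ B := by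
  have hpos : ∀ f : 𝔼 n → ℝ, 0 ≤ ∫ y, |f y| := fun f => integral_nonneg fun y => abs_nonneg _
  have hs : 0 ≤ ∑ j, ∫ y, |pd j Φ y| := Finset.sum_nonneg fun j _ => hpos _
  refine ⟨(∫ y, |Φ y|) + ∑ j, ∫ y, |pd j Φ y|, add_nonneg (hpos _) hs,
    le_add_of_nonneg_right hs, fun j => ?_⟩
  have := Finset.single_le_sum (f := fun j => ∫ y, |pd j Φ y|) (fun j _ => hpos _)
    (Finset.mem_univ j)
  linarith [hpos Φ]

/-- A smooth function supported in the closed unit ball. -/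
structure IsUnitKernel (Φ : 𝔼 n → ℝ) : Prop where
  contDiff : ContDiff ℝ (⊤ : ℕ∞) Φ
  eq_zero : ∀ y, 1 < ‖y‖ → Φ y = 0

namespace IsUnitKernel

variable {Φ : 𝔼 n → ℝ}

lemma hasCompactSupport (h : IsUnitKernel Φ) : HasCompactSupport Φ :=
  HasCompactSupport.intro (isCompact_closedBall (0 : 𝔼 n) 1)
    fun y hy => h.eq_zero y (by simpa using hy)

lemma pd (h : IsUnitKernel Φ) (j : Fin n) : IsUnitKernel (pd j Φ) where
  contDiff := (h.contDiff.fderiv_right (by simp)).clm_apply contDiff_const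
  eq_zero y hy := by
    have : Φ =ᶠ[𝓝 y] fun _ => 0 := by
      filter_upwards [(isOpen_lt continuous_const continuous_norm).mem_nhds hy] with z hz
      exact h.eq_zero z hz
    simp [_root_.pd, this.fderiv_eq]

lemma differentiable_const_mul_scaledConv {f : 𝔼 n → ℝ} {s : ℝ} (h : IsUnitKernel Φ)
    (hs : 0 < s) (hf : Continuous f) (c : ℝ) :
    Differentiable ℝ fun x => c * scaledConv s Φ f x :=
  ((contDiff_scaledConv hs h.contDiff h.hasCompactSupport
    hf.locallyIntegrable).differentiable (by simp)).const_mul c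

lemma pd_const_mul_scaledConv {f : 𝔼 n → ℝ} {s : ℝ} (h : IsUnitKernel Φ)
    (hs : 0 < s) (hf : Continuous f) (c : ℝ) (j : Fin n) :
    _root_.pd j (fun x => c * scaledConv s Φ f x) =
      fun x => c * s⁻¹ * scaledConv s (_root_.pd j Φ) f x := by
  have hd := (contDiff_scaledConv hs h.contDiff h.hasCompactSupport
    hf.locallyIntegrable).differentiable (by simp)
  ext x
  have := congrFun (pd_scaledConv_kernel hs h.contDiff h.hasCompactSupport
    hf.locallyIntegrable j) x
  simp only [_root_.pd] at this ⊢
  rw [fderiv_const_mul (hd x), smul_apply, this, smul_eq_mul, mul_assoc]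

end IsUnitKernel

/-- The superposition of the smoothings of `f` at the scales `t / 2 ^ m`, weighted by the square of
the scale. -/
def dyadicPotential (t : ℝ) (Φ f : 𝔼 n → ℝ) (x : 𝔼 n) : ℝ :=
  ∑' m : ℕ, (t * (1 / 2) ^ m) ^ 2 * scaledConv (t * (1 / 2) ^ m) Φ f x

section DyadicPotential

variable {t : ℝ} {Φ f : 𝔼 n → ℝ}

lemma summable_mul_half_pow_sq (ht : 0 < t) (C : ℝ) :
    Summable fun m : ℕ => C * (t * (1 / 2) ^ m) ^ 2 := by
  simpa only [Real.rpow_two] using summable_mul_half_pow_rpow ht zero_lt_two C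

lemma abs_dyadicPotential_term_le {M : ℝ} (hΦ : IsUnitKernel Φ) (hM : ∀ x, |f x| ≤ M)
    (m : ℕ) (x : 𝔼 n) : |(t * (1 / 2) ^ m) ^ 2 * scaledConv (t * (1 / 2) ^ m) Φ f x| ≤
      M * (∫ y, |Φ y|) * (t * (1 / 2) ^ m) ^ 2 := by
  rw [abs_mul, abs_of_nonneg (sq_nonneg _), mul_comm]
  gcongr
  exact abs_scaledConv_le hΦ.contDiff.continuous hΦ.hasCompactSupport hM x

lemma differentiable_dyadicPotential (ht : 0 < t) (hΦ : IsUnitKernel Φ) (hf : Continuous f)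
    (hfc : HasCompactSupport f) : Differentiable ℝ (dyadicPotential t Φ f) ∧
      ∀ j, pd j (dyadicPotential t Φ f) = fun x => ∑' m : ℕ,
        pd j (fun x => (t * (1 / 2) ^ m) ^ 2 * scaledConv (t * (1 / 2) ^ m) Φ f x) x := by
  obtain ⟨M, hM⟩ := hf.bounded_above_of_compact_support hfc
  have hM0 : 0 ≤ M := (norm_nonneg _).trans (hM 0)
  obtain ⟨B, hB0, -, hB⟩ := exists_integral_pd_le Φ
  have hs : ∀ m : ℕ, 0 < t * (1 / 2) ^ m := fun m => by positivity
  refine differentiable_tsum_of_pd (b := fun m => M * B * (t * (1 / 2) ^ m) ^ (1 : ℝ))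
    (fun m => hΦ.differentiable_const_mul_scaledConv (hs m) hf _)
    (summable_mul_half_pow_sq ht _) (summable_mul_half_pow_rpow ht one_pos _)
    (abs_dyadicPotential_term_le hΦ hM) fun j m x => ?_
  rw [hΦ.pd_const_mul_scaledConv (hs m) hf, sq, mul_inv_cancel_right₀ (hs m).ne', abs_mul,
    abs_of_pos (hs m), Real.rpow_one, mul_comm]
  have := abs_scaledConv_le (t := t * (1 / 2) ^ m) (hΦ.pd j).contDiff.continuous
    (hΦ.pd j).hasCompactSupport hM x
  have h2 := mul_le_mul_of_nonneg_left (hB j) hM0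
  exact mul_le_mul_of_nonneg_right (this.trans h2) (hs m).le

lemma pd_dyadicPotential_apply (ht : 0 < t) (hΦ : IsUnitKernel Φ) (hf : ContDiff ℝ 1 f)
    (hfc : HasCompactSupport f) (j : Fin n) :
    pd j (dyadicPotential t Φ f) = dyadicPotential t Φ (pd j f) := by
  rw [(differentiable_dyadicPotential ht hΦ hf.continuous hfc).2 j]
  ext x
  refine tsum_congr fun m => ?_
  obtain ⟨hd, hpd⟩ := pd_scaledConv_apply (t := t * (1 / 2) ^ m) (by positivity)
    hΦ.contDiff.continuous hf hfc j
  rw [← hpd]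
  simp only [pd]
  rw [fderiv_const_mul (hd x)]
  rfl

lemma pd_dyadicPotential_kernel (ht : 0 < t) (hΦ : IsUnitKernel Φ) (hf : Continuous f)
    (hfc : HasCompactSupport f) (j : Fin n) :
    pd j (dyadicPotential t Φ f) = fun x => ∑' m : ℕ,
        t * (1 / 2) ^ m * scaledConv (t * (1 / 2) ^ m) (pd j Φ) f x := by
  rw [(differentiable_dyadicPotential ht hΦ hf hfc).2 j]
  ext x
  refine tsum_congr fun m => ?_
  have hs : 0 < t * (1 / 2) ^ m := by positivity
  rw [hΦ.pd_const_mul_scaledConv hs hf, sq, mul_inv_cancel_right₀ hs.ne']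

lemma holderClass_two_dyadicPotential (hα : α ∈ Ioo (0 : ℝ) 1) (ht : 0 < t)
    (hΦ : IsUnitKernel Φ) (hf : LocallyHolderOn α f univ) (hfc : HasCompactSupport f) :
    HolderClass α univ 2 (dyadicPotential t Φ f) := by
  have hcont : Continuous f := by simpa using hf.continuousOn hα.1
  obtain ⟨C, hC0, hC⟩ := exists_holder_of_hasCompactSupport hα.1 hf hfc
  obtain ⟨M, hM⟩ := hcont.bounded_above_of_compact_support hfc
  have hs : ∀ m : ℕ, 0 < t * (1 / 2) ^ m := fun m => by positivity
  have key : ∀ {Ψ : 𝔼 n → ℝ}, IsUnitKernel Ψ → ∀ j m x,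
      |scaledConv (t * (1 / 2) ^ m) (pd j Ψ) f x| ≤
        C * (t * (1 / 2) ^ m) ^ α * ∫ y, |pd j Ψ y| := fun hΨ j m x =>
    abs_scaledConv_le_of_holder hα.1 (hs m) (hΨ.pd j).contDiff.continuous (hΨ.pd j).eq_zero
      (integral_pd_eq_zero hΨ.contDiff hΨ.hasCompactSupport j) hcont hC hC0 x
  refine ⟨(differentiable_dyadicPotential ht hΦ hcont hfc).1.differentiableOn, fun j => ?_⟩
  rw [pd_dyadicPotential_kernel ht hΦ hcont hfc]
  obtain ⟨B, hB0, hB1, hB⟩ := exists_integral_pd_le (pd j Φ)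
  have hbound : ∀ i m x, |scaledConv (t * (1 / 2) ^ m) (pd i (pd j Φ)) f x| ≤
      C * B * (t * (1 / 2) ^ m) ^ α := fun i m x => by
    refine (key (hΦ.pd j) i m x).trans ?_
    rw [mul_right_comm]
    have := hB i
    gcongr
  have hpd : ∀ i m, pd i (fun x => t * (1 / 2) ^ m * scaledConv (t * (1 / 2) ^ m) (pd j Φ) f x) =
      scaledConv (t * (1 / 2) ^ m) (pd i (pd j Φ)) f := fun i m => by
    ext x
    rw [(hΦ.pd j).pd_const_mul_scaledConv (hs m) hcont, mul_inv_cancel₀ (hs m).ne']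
    exact one_mul _
  obtain ⟨hd, hd'⟩ := differentiable_tsum_of_pd
    (w := fun m x => t * (1 / 2) ^ m * scaledConv (t * (1 / 2) ^ m) (pd j Φ) f x)
    (a := fun m => M * B * (t * (1 / 2) ^ m) ^ (1 : ℝ))
    (b := fun m => C * B * (t * (1 / 2) ^ m) ^ α)
    (fun m => (hΦ.pd j).differentiable_const_mul_scaledConv (hs m) hcont _)
    (summable_mul_half_pow_rpow ht one_pos _) (summable_mul_half_pow_rpow ht hα.1 _)
    (fun m x => by
      rw [abs_mul, abs_of_pos (hs m), Real.rpow_one, mul_comm]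
      have := abs_scaledConv_le (t := t * (1 / 2) ^ m) (hΦ.pd j).contDiff.continuous
        (hΦ.pd j).hasCompactSupport hM x
      have h2 := mul_le_mul_of_nonneg_left hB1 ((norm_nonneg _).trans (hM 0))
      exact mul_le_mul_of_nonneg_right (this.trans h2) (hs m).le)
    (fun i m x => by rw [hpd]; exact hbound i m x)
  refine ⟨hd.differentiableOn, fun i => ?_⟩
  rw [hd' i]
  simp_rw [hpd]
  have hΦ2 := (hΦ.pd j).pd i
  obtain ⟨B', hB'0, -, hB'⟩ := exists_integral_pd_le (pd i (pd j Φ))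
  have hone : ∀ m, scaledConv (t * (1 / 2) ^ m) (pd i (pd j Φ)) f =
      fun x => 1 * scaledConv (t * (1 / 2) ^ m) (pd i (pd j Φ)) f x := fun m => by simp
  obtain ⟨K, hK⟩ := exists_holder_tsum (B := C * B')
    (w := fun m => scaledConv (t * (1 / 2) ^ m) (pd i (pd j Φ)) f) hα ht
    (fun m => by rw [hone]; exact hΦ2.differentiable_const_mul_scaledConv (hs m) hcont 1)
    (hbound i) (fun l m x => by
      rw [hone, hΦ2.pd_const_mul_scaledConv (hs m) hcont, one_mul, abs_mul,
        abs_of_pos (inv_pos.2 (hs m)), Real.rpow_sub_one (hs m).ne',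
        div_eq_inv_mul ((t * (1 / 2) ^ m) ^ α),
        mul_left_comm]
      refine mul_le_mul_of_nonneg_left ((key hΦ2 l m x).trans ?_) (inv_pos.2 (hs m)).le
      rw [mul_right_comm]
      have := hB' l
      gcongr) (by positivity)
  exact fun x _ => ⟨univ, univ_mem, K, fun y _ z _ => hK y z⟩

lemma holderClass_dyadicPotential {k : ℕ} (hα : α ∈ Ioo (0 : ℝ) 1) (ht : 0 < t)
    (hΦ : IsUnitKernel Φ) (hf : HolderClass α univ k f) (hfc : HasCompactSupport f) :
    HolderClass α univ (k + 2) (dyadicPotential t Φ f) := by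
  induction k generalizing f with
  | zero => exact holderClass_two_dyadicPotential hα ht hΦ hf hfc
  | succ k ih =>
    have hf1 : ContDiff ℝ 1 f := (contDiffOn_univ.1
      ((HolderClass.iff_pdIter hα.1 isOpen_univ).1 hf).1).of_le (by simp)
    refine ⟨(differentiable_dyadicPotential ht hΦ hf1.continuous hfc).1.differentiableOn,
      fun j => ?_⟩
    rw [pd_dyadicPotential_apply ht hΦ hf1 hfc]
    exact ih (hf.2 j) (hfc.fderiv_apply ℝ _)

end DyadicPotential

/-! ### A kernel whose rescalings differ by a Laplacian -/

lemma pd_comp_norm_sq {G : ℝ → ℝ} (hG : Differentiable ℝ G) (j : Fin n) (x : 𝔼 n) :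
    pd j (fun x => G (‖x‖ ^ 2)) x = 2 * x j * deriv G (‖x‖ ^ 2) := by
  have h := (hG (‖x‖ ^ 2)).hasDerivAt.comp_hasFDerivAt x
    (hasStrictFDerivAt_norm_sq x).hasFDerivAt
  have h' : fderiv ℝ (fun x : 𝔼 n => G (‖x‖ ^ 2)) x = _ := h.fderiv
  rw [pd, h']
  simp [EuclideanSpace.inner_single_right]
  ring

lemma sum_pd_pd_comp_norm_sq {G : ℝ → ℝ} (hG : Differentiable ℝ G)
    (hG' : Differentiable ℝ (deriv G)) (x : 𝔼 n) :
    ∑ j, pd j (pd j fun x => G (‖x‖ ^ 2)) x =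
      4 * ‖x‖ ^ 2 * deriv (deriv G) (‖x‖ ^ 2) + 2 * n * deriv G (‖x‖ ^ 2) := by
  have key : ∀ j, pd j (pd j fun x => G (‖x‖ ^ 2)) x =
      4 * (x j) ^ 2 * deriv (deriv G) (‖x‖ ^ 2) + 2 * deriv G (‖x‖ ^ 2) := fun j => by
    rw [funext (pd_comp_norm_sq hG j)]
    have h1 : HasFDerivAt (fun x : 𝔼 n => 2 * x j)
        ((2 : ℝ) • (EuclideanSpace.proj j : 𝔼 n →L[ℝ] ℝ)) x :=
      (EuclideanSpace.proj j : 𝔼 n →L[ℝ] ℝ).hasFDerivAt.const_mul 2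
    have h2 : DifferentiableAt ℝ (fun x : 𝔼 n => deriv G (‖x‖ ^ 2)) x :=
      (hG' _).comp x (hasStrictFDerivAt_norm_sq x).hasFDerivAt.differentiableAt
    have h3 := pd_comp_norm_sq hG' j x
    rw [pd] at h3 ⊢
    have h4 : fderiv ℝ (fun x : 𝔼 n => 2 * x j * deriv G (‖x‖ ^ 2)) x = _ :=
      (h1.mul h2.hasFDerivAt).fderiv
    rw [h4]
    simp [h3]
    ring
  rw [Finset.sum_congr rfl fun j _ => key j, Finset.sum_add_distrib, ← Finset.sum_mul,
    ← Finset.mul_sum, ← EuclideanSpace.real_norm_sq_eq]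
  simp
  ring

/-- A smooth function equal to `s ^ (-n / 2)` for `1 ≤ s` and vanishing for `s ≤ 1 / 2`. -/
def radialProfile (n : ℕ) (s : ℝ) : ℝ :=
  Real.smoothTransition (2 * s - 1) * s ^ (-(n / 2 : ℝ))

lemma radialProfile_eventuallyEq_zero {s : ℝ} (hs : s < 1 / 2) :
    radialProfile n =ᶠ[𝓝 s] fun _ => 0 := by
  filter_upwards [gt_mem_nhds hs] with r hr
  rw [radialProfile, Real.smoothTransition.zero_of_nonpos (by linarith), zero_mul]

lemma contDiff_radialProfile : ContDiff ℝ (⊤ : ℕ∞) (radialProfile n) := by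
  rw [contDiff_iff_contDiffAt]
  intro s
  rcases lt_or_ge s (1 / 2) with hs | hs
  · exact contDiffAt_const.congr_of_eventuallyEq (radialProfile_eventuallyEq_zero hs)
  · have h1 : ContDiff ℝ (⊤ : ℕ∞) fun s : ℝ => Real.smoothTransition (2 * s - 1) :=
      Real.smoothTransition.contDiff.comp ((contDiff_const.mul contDiff_id).sub contDiff_const)
    exact h1.contDiffAt.mul (Real.contDiffAt_rpow_const_of_ne (by linarith))

lemma radialProfile_four_mul {s : ℝ} (hs : 1 ≤ s) :
    radialProfile n s = 2 ^ n * radialProfile n (4 * s) := by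
  have h4 : (4 : ℝ) ^ (-(n / 2 : ℝ)) = (2 ^ n)⁻¹ := by
    rw [show (4 : ℝ) = 2 ^ (2 : ℝ) by norm_num, ← Real.rpow_mul zero_le_two,
      ← Real.rpow_natCast, ← Real.rpow_neg zero_le_two]
    ring_nf
  rw [radialProfile, radialProfile, Real.smoothTransition.one_of_one_le (by linarith),
    Real.smoothTransition.one_of_one_le (by linarith),
    Real.mul_rpow (by norm_num) (by linarith), h4]
  field_simp

/-- If `p` is the derivative of `G`, then `4 s p' + 2 n p` gives the Laplacian
of `x ↦ G (‖x‖ ^ 2)`. -/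
def radialDivergence (n : ℕ) (p : ℝ → ℝ) (s : ℝ) : ℝ :=
  4 * s * deriv p s + 2 * n * p s

lemma radialDivergence_radialProfile (s : ℝ) : radialDivergence n (radialProfile n) s =
    4 * s * s ^ (-(n / 2 : ℝ)) * deriv (fun s => Real.smoothTransition (2 * s - 1)) s := by
  have hd : Differentiable ℝ fun s : ℝ => Real.smoothTransition (2 * s - 1) :=
    (Real.smoothTransition.contDiff (n := 1).differentiable (by simp)).comp (by fun_prop)
  rcases lt_or_ge s (1 / 2) with hs | hs
  · have h0 : (fun s => Real.smoothTransition (2 * s - 1)) =ᶠ[𝓝 s] fun _ => 0 := by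
      filter_upwards [gt_mem_nhds hs] with r hr
      exact Real.smoothTransition.zero_of_nonpos (by linarith)
    have h1 := radialProfile_eventuallyEq_zero (n := n) hs
    rw [radialDivergence, h0.deriv_eq, h1.deriv_eq, h1.eq_of_nhds]
    simp
  · have hs0 : s ≠ 0 := by linarith
    have h := (hd s).hasDerivAt.mul (Real.hasDerivAt_rpow_const (p := -(n / 2 : ℝ)) (Or.inl hs0))
    have h' : deriv (radialProfile n) s = _ := h.deriv
    rw [radialDivergence, h', radialProfile, Real.rpow_sub_one hs0]
    field_simp
    ring

lemma exists_laplacian_eq_sub (hn : 1 ≤ n) : ∃ Φ η : 𝔼 n → ℝ, IsUnitKernel Φ ∧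
    IsUnitKernel η ∧ ∫ y, η y ≠ 0 ∧
    ∀ x, ∑ j, pd j (pd j Φ) x = η x - 2 ^ n * η ((2 : ℝ) • x) := by
  set b := radialProfile n with hb
  set p : ℝ → ℝ := fun s => b s - 2 ^ n * b (4 * s) with hp
  have hbs : ContDiff ℝ (⊤ : ℕ∞) b := contDiff_radialProfile
  have hbd : Differentiable ℝ b := hbs.differentiable (by simp)
  have hps : ContDiff ℝ (⊤ : ℕ∞) p :=
    hbs.sub (contDiff_const.mul (hbs.comp (contDiff_const.mul contDiff_id)))
  have hp1 : ∀ s, 1 ≤ s → p s = 0 := fun s hs => sub_eq_zero.2 (radialProfile_four_mul hs)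
  set G : ℝ → ℝ := fun s => ∫ r in (1 : ℝ)..s, p r with hG
  have hGd : ∀ s, HasDerivAt G (p s) s := fun s =>
    (hps.continuous.integral_hasStrictDerivAt 1 s).hasDerivAt
  have hG' : deriv G = p := funext fun s => (hGd s).deriv
  have hGs : ContDiff ℝ (⊤ : ℕ∞) G := by
    rw [contDiff_infty_iff_deriv, hG']
    exact ⟨fun s => (hGd s).differentiableAt, hps⟩
  have hG1 : ∀ s, 1 ≤ s → G s = 0 := fun s hs => by
    rw [hG]
    refine (intervalIntegral.integral_congr (g := fun _ => (0 : ℝ)) fun r hr => ?_).trans (by simp)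
    rw [uIcc_of_le hs] at hr
    exact hp1 r hr.1
  have hθ : Monotone fun s : ℝ => Real.smoothTransition (2 * s - 1) := fun r s hrs =>
    Real.smoothTransition.monotone (by linarith)
  have hsq : ContDiff ℝ (⊤ : ℕ∞) fun x : 𝔼 n => ‖x‖ ^ 2 := contDiff_norm_sq ℝ
  have hone : ∀ {x : 𝔼 n}, 1 < ‖x‖ → 1 < ‖x‖ ^ 2 := fun hx => one_lt_pow₀ hx two_ne_zero
  have hη : IsUnitKernel fun x : 𝔼 n => radialDivergence n b (‖x‖ ^ 2) := by
    constructor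
    · have : ContDiff ℝ (⊤ : ℕ∞) (radialDivergence n b) :=
        ((contDiff_const.mul contDiff_id).mul (contDiff_infty_iff_deriv.1 hbs).2).add
          (contDiff_const.mul hbs)
      exact this.comp hsq
    · intro x hx
      have h0 : (fun s => Real.smoothTransition (2 * s - 1)) =ᶠ[𝓝 (‖x‖ ^ 2)] fun _ => 1 := by
        filter_upwards [lt_mem_nhds (hone hx)] with r hr
        exact Real.smoothTransition.one_of_one_le (by linarith)
      simp only [hb]
      rw [radialDivergence_radialProfile, h0.deriv_eq]
      simp
  refine ⟨fun x => G (‖x‖ ^ 2), fun x => radialDivergence n b (‖x‖ ^ 2), ⟨hGs.comp hsq,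
    fun x hx => hG1 _ (hone hx).le⟩, hη, ?_, fun x => ?_⟩
  · obtain ⟨s, hs, hs'⟩ := exists_deriv_eq_slope
      (fun s : ℝ => Real.smoothTransition (2 * s - 1)) (by norm_num : (1 / 2 : ℝ) < 1)
      (Real.smoothTransition.continuous.comp (by fun_prop)).continuousOn
      ((Real.smoothTransition.contDiff (n := 1).differentiable (by simp)).comp
        (by fun_prop : Differentiable ℝ fun s : ℝ => 2 * s - 1)).differentiableOn
    have hs0 : 0 < s := by linarith [hs.1]
    refine (hη.contDiff.continuous.integral_pos_of_hasCompactSupport_nonneg_nonzero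
      (x := EuclideanSpace.single ⟨0, hn⟩ √s) hη.hasCompactSupport (fun x => ?_) ?_).ne'
    · simp only [hb]
      rw [radialDivergence_radialProfile]
      have := hθ.deriv_nonneg (x := ‖x‖ ^ 2)
      positivity
    · have : ‖(EuclideanSpace.single ⟨0, hn⟩ √s : 𝔼 n)‖ ^ 2 = s := by
        simp [Real.sq_sqrt hs0.le]
      simp only [hb]
      rw [this, radialDivergence_radialProfile, hs']
      norm_num
      exact ⟨hs0.ne', (Real.rpow_pos_of_pos hs0 _).ne'⟩
  · rw [sum_pd_pd_comp_norm_sq (hGs.differentiable (by simp))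
      (by rw [hG']; exact hps.differentiable (by simp)), hG']
    have h4 : HasDerivAt (fun s : ℝ => b (4 * s)) (deriv b (4 * ‖x‖ ^ 2) * 4) (‖x‖ ^ 2) := by
      have h5 : HasDerivAt (fun s : ℝ => 4 * s) 4 (‖x‖ ^ 2) := by
        simpa using (hasDerivAt_id (‖x‖ ^ 2)).const_mul (4 : ℝ)
      exact (hbd _).hasDerivAt.comp _ h5
    have h6 : deriv p (‖x‖ ^ 2) = _ := ((hbd _).hasDerivAt.sub (h4.const_mul (2 ^ n))).deriv
    have h7 : ‖(2 : ℝ) • x‖ ^ 2 = 4 * ‖x‖ ^ 2 := by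
      rw [norm_smul, mul_pow]
      norm_num
    simp only [radialDivergence, h7]
    rw [h6]
    simp only [hp]
    ring

/-! ### The Poisson equation tested against rescaled kernels -/

lemma scaledConv_eq_integral {t : ℝ} (ht : 0 < t) (Φ f : 𝔼 n → ℝ) (x : 𝔼 n) :
    scaledConv t Φ f x = (t ^ n)⁻¹ * ∫ y, f y * Φ (t⁻¹ • (x - y)) := by
  rw [scaledConv_eq_convolution ht]
  rfl

lemma scaledConv_const (t c : ℝ) (Φ : 𝔼 n → ℝ) (x : 𝔼 n) :
    scaledConv t Φ (fun _ => c) x = c * ∫ y, Φ y :=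
  integral_const_mul _ _

lemma pd_comp_smul_sub {Φ : 𝔼 n → ℝ} (hΦ : Differentiable ℝ Φ) (s : ℝ) (x : 𝔼 n) (j : Fin n) :
    pd j (fun y => Φ (s • (x - y))) = fun y => -s * pd j Φ (s • (x - y)) := by
  ext y
  have h1 : HasFDerivAt (fun y : 𝔼 n => s • (x - y)) (s • -ContinuousLinearMap.id ℝ (𝔼 n)) y :=
    ((hasFDerivAt_id y).const_sub x).const_smul s
  have h2 : fderiv ℝ (fun y => Φ (s • (x - y))) y = _ :=
    ((hΦ _).hasFDerivAt.comp y h1).fderiv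
  rw [pd, h2, pd]
  simp

lemma pd_const_mul (c : ℝ) (f : 𝔼 n → ℝ) (j : Fin n) :
    pd j (fun y => c * f y) = fun y => c * pd j f y := by
  ext y
  have : fderiv ℝ (fun y => c * f y) y = c • fderiv ℝ f y := congrFun (fderiv_const_smul_field c) y
  rw [pd, this]
  rfl

namespace IsUnitKernel

variable {Φ : 𝔼 n → ℝ} {t : ℝ}

lemma comp_smul_sub_eq_zero (h : IsUnitKernel Φ) (ht : 0 < t) {x y : 𝔼 n}
    (hy : y ∉ Metric.closedBall x t) : Φ (t⁻¹ • (x - y)) = 0 := by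
  refine h.eq_zero _ ?_
  rw [Metric.mem_closedBall, dist_comm, dist_eq_norm, not_le] at hy
  rwa [norm_smul, norm_inv, Real.norm_of_nonneg ht.le, ← div_eq_inv_mul, one_lt_div ht]

lemma hasCompactSupport_comp_smul_sub (h : IsUnitKernel Φ) (ht : 0 < t) (x : 𝔼 n) :
    HasCompactSupport fun y => Φ (t⁻¹ • (x - y)) :=
  HasCompactSupport.intro (isCompact_closedBall x t) fun _ => h.comp_smul_sub_eq_zero ht

lemma tsupport_comp_smul_sub_subset (h : IsUnitKernel Φ) (ht : 0 < t) (x : 𝔼 n) :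
    tsupport (fun y => Φ (t⁻¹ • (x - y))) ⊆ Metric.closedBall x t :=
  closure_minimal (fun _ hy => by_contra fun hy' => hy (h.comp_smul_sub_eq_zero ht hy'))
    Metric.isClosed_closedBall

lemma contDiff_comp_smul_sub (h : IsUnitKernel Φ) (t : ℝ) (x : 𝔼 n) :
    ContDiff ℝ (⊤ : ℕ∞) fun y => Φ (t⁻¹ • (x - y)) :=
  h.contDiff.comp ((contDiff_const.sub contDiff_id).const_smul _)

lemma integrable_mul_comp_smul_sub (h : IsUnitKernel Φ) (ht : 0 < t) {f : 𝔼 n → ℝ}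
    (hf : LocallyIntegrable f) (x : 𝔼 n) : Integrable fun y => f y * Φ (t⁻¹ • (x - y)) := by
  simpa only [smul_eq_mul, mul_comm] using hf.integrable_smul_left_of_hasCompactSupport
    (h.contDiff_comp_smul_sub t x).continuous (h.hasCompactSupport_comp_smul_sub ht x)

lemma pd_pd_comp_smul_sub (h : IsUnitKernel Φ) (t : ℝ) (x : 𝔼 n) (j : Fin n) :
    _root_.pd j (_root_.pd j fun y => Φ (t⁻¹ • (x - y))) =
      fun y => (t ^ 2)⁻¹ * _root_.pd j (_root_.pd j Φ) (t⁻¹ • (x - y)) := by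
  rw [pd_comp_smul_sub (h.contDiff.differentiable (by simp)), pd_const_mul,
    pd_comp_smul_sub ((h.pd j).contDiff.differentiable (by simp))]
  ext y
  ring

end IsUnitKernel

lemma setIntegral_mul_eq_integral {Ω s : Set (𝔼 n)} (hs : s ⊆ Ω) {u v φ : 𝔼 n → ℝ}
    (h : EqOn u v s) (hφ : ∀ y ∉ s, φ y = 0) : ∫ y in Ω, u y * φ y = ∫ y, v y * φ y := by
  rw [setIntegral_eq_integral_of_forall_compl_eq_zero fun y hy => by
    rw [hφ y fun h => hy (hs h), mul_zero]]
  refine integral_congr_ae (Eventually.of_forall fun y => ?_)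
  by_cases hy : y ∈ s
  · simp only [h hy]
  · simp only [hφ y hy, mul_zero]

section Poisson

variable {Ω : Set (𝔼 n)} {f u : 𝔼 n → ℝ} {Φ η : 𝔼 n → ℝ}

lemma scaledConv_sub_scaledConv_half (hΦ : IsUnitKernel Φ) (hη : IsUnitKernel η)
    (hΦη : ∀ x, ∑ j, pd j (pd j Φ) x = η x - 2 ^ n * η ((2 : ℝ) • x))
    (hdist : ∀ φ : 𝔼 n → ℝ, ContDiff ℝ (⊤ : ℕ∞) φ → HasCompactSupport φ → tsupport φ ⊆ Ω →
      ∫ x in Ω, u x * (∑ j, pd j (pd j φ) x) = ∫ x in Ω, f x * φ x)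
    {t : ℝ} (ht : 0 < t) {x : 𝔼 n} (hx : Metric.closedBall x t ⊆ Ω) {v g : 𝔼 n → ℝ}
    (hv : LocallyIntegrable v) (huv : EqOn u v (Metric.closedBall x t))
    (hfg : EqOn f g (Metric.closedBall x t)) :
    scaledConv t η v x - scaledConv (t / 2) η v x = t ^ 2 * scaledConv t Φ g x := by
  have ht2 : 0 < t / 2 := half_pos ht
  have hw := hdist _ (hΦ.contDiff_comp_smul_sub t x) (hΦ.hasCompactSupport_comp_smul_sub ht x)
    ((hΦ.tsupport_comp_smul_sub_subset ht x).trans hx)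
  have hΔ : ∀ y, ∑ j, pd j (pd j fun y => Φ (t⁻¹ • (x - y))) y =
      (t ^ 2)⁻¹ * ∑ j, pd j (pd j Φ) (t⁻¹ • (x - y)) := fun y => by
    rw [Finset.mul_sum]
    exact Finset.sum_congr rfl fun j _ => congrFun (hΦ.pd_pd_comp_smul_sub t x j) y
  rw [setIntegral_mul_eq_integral hx hfg fun y => hΦ.comp_smul_sub_eq_zero ht,
    setIntegral_mul_eq_integral hx huv fun y hy => by
      rw [hΔ, Finset.sum_eq_zero fun j _ => ((hΦ.pd j).pd j).comp_smul_sub_eq_zero ht hy,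
        mul_zero]] at hw
  rw [scaledConv_eq_integral ht Φ, ← hw, scaledConv_eq_integral ht, scaledConv_eq_integral ht2]
  have hsmul : ∀ y, (2 : ℝ) • t⁻¹ • (x - y) = (t / 2)⁻¹ • (x - y) := fun y => by
    rw [smul_smul, inv_div, div_eq_mul_inv]
  have key : ∫ y, v y * ∑ j, pd j (pd j fun y => Φ (t⁻¹ • (x - y))) y = (t ^ 2)⁻¹ *
      ((∫ y, v y * η (t⁻¹ • (x - y))) - 2 ^ n * ∫ y, v y * η ((t / 2)⁻¹ • (x - y))) := by
    rw [← integral_const_mul (2 ^ n), ← integral_sub (hη.integrable_mul_comp_smul_sub ht hv x)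
      ((hη.integrable_mul_comp_smul_sub ht2 hv x).const_mul _), ← integral_const_mul]
    refine integral_congr_ae (Eventually.of_forall fun y => ?_)
    simp only [hΔ, hΦη, hsmul]
    ring
  rw [key, div_pow]
  field_simp

lemma abs_scaledConv_le_average (hη : IsUnitKernel η) {B : ℝ} (hB : ∀ y, |η y| ≤ B)
    {t : ℝ} (ht : 0 < t) {g : 𝔼 n → ℝ} (hg : LocallyIntegrable g) (x : 𝔼 n) :
    |scaledConv t η g x| ≤ B * volume.real (Metric.ball (0 : 𝔼 n) 1) *
      ⨍ y in Metric.closedBall x t, ‖g y‖ := by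
  have hvol : 0 < volume.real (Metric.ball (0 : 𝔼 n) 1) :=
    ENNReal.toReal_pos (Metric.measure_ball_pos _ _ one_pos).ne' measure_ball_lt_top.ne
  have hfint : |∫ y, g y * η (t⁻¹ • (x - y))| ≤ B * ∫ y in Metric.closedBall x t, ‖g y‖ := by
    rw [← setIntegral_eq_integral_of_forall_compl_eq_zero (s := Metric.closedBall x t)
      fun y hy => by rw [hη.comp_smul_sub_eq_zero ht hy, mul_zero], ← integral_const_mul,
      ← Real.norm_eq_abs]
    refine norm_integral_le_of_norm_le
      ((hg.integrableOn_isCompact (isCompact_closedBall x t)).norm.const_mul B)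
      (Eventually.of_forall fun y => ?_)
    rw [norm_mul, mul_comm]
    exact mul_le_mul_of_nonneg_right (hB _) (norm_nonneg _)
  rw [scaledConv_eq_integral ht, abs_mul, abs_of_nonneg (by positivity), setAverage_eq,
    Measure.addHaar_real_closedBall _ _ ht.le, finrank_euclideanSpace_fin, smul_eq_mul]
  calc _ ≤ (t ^ n)⁻¹ * (B * ∫ y in Metric.closedBall x t, ‖g y‖) := by gcongr
    _ = _ := by field_simp

lemma tendsto_mul_half_pow {t : ℝ} (ht : 0 < t) :
    Tendsto (fun m : ℕ => t * (1 / 2) ^ m) atTop (𝓝[>] 0) := by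
  refine tendsto_nhdsWithin_iff.2 ⟨?_, Eventually.of_forall fun m => by simp [ht]⟩
  simpa using (tendsto_pow_atTop_nhds_zero_of_lt_one (r := (1 / 2 : ℝ)) (by norm_num)
    (by norm_num)).const_mul t

lemma ae_tendsto_scaledConv (hη : IsUnitKernel η) {v : 𝔼 n → ℝ} (hv : LocallyIntegrable v)
    {t : ℝ} (ht : 0 < t) : ∀ᵐ x, Tendsto (fun m : ℕ => scaledConv (t * (1 / 2) ^ m) η v x) atTop
      (𝓝 ((∫ y, η y) * v x)) := by
  obtain ⟨B, hB⟩ := hη.contDiff.continuous.bounded_above_of_compact_support hη.hasCompactSupport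
  filter_upwards [IsUnifLocDoublingMeasure.ae_tendsto_average_norm_sub volume hv 1] with x hx
  have hδ := tendsto_mul_half_pow ht
  have hlim := (hx (fun _ => x) _ hδ (Eventually.of_forall fun m =>
    Metric.mem_closedBall_self (by positivity))).const_mul
      (B * volume.real (Metric.ball (0 : 𝔼 n) 1))
  rw [mul_zero] at hlim
  refine tendsto_iff_norm_sub_tendsto_zero.2 (squeeze_zero (fun _ => norm_nonneg _)
    (fun m => ?_) hlim)
  have hs : 0 < t * (1 / 2) ^ m := by positivity
  have hsub : scaledConv (t * (1 / 2) ^ m) η v x - (∫ y, η y) * v x =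
      scaledConv (t * (1 / 2) ^ m) η (fun y => v y - v x) x := by
    have hc := hη.integrable_mul_comp_smul_sub hs (locallyIntegrable_const (v x)) x
    rw [mul_comm (∫ y, η y), ← scaledConv_const (t * (1 / 2) ^ m), scaledConv_eq_integral hs,
      scaledConv_eq_integral hs, scaledConv_eq_integral hs, ← mul_sub,
      ← integral_sub (hη.integrable_mul_comp_smul_sub hs hv x) hc]
    simp only [sub_mul]
  rw [hsub]
  exact abs_scaledConv_le_average hη hB hs (hv.sub (locallyIntegrable_const _)) x

lemma dyadicPotential_eq_sub (hΦ : IsUnitKernel Φ) {t M L : ℝ} (ht : 0 < t) {v g : 𝔼 n → ℝ}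
    {x : 𝔼 n} (hg : ∀ y, |g y| ≤ M)
    (h : ∀ m : ℕ, scaledConv (t * (1 / 2) ^ m) η v x - scaledConv (t * (1 / 2) ^ m / 2) η v x =
      (t * (1 / 2) ^ m) ^ 2 * scaledConv (t * (1 / 2) ^ m) Φ g x)
    (hL : Tendsto (fun m : ℕ => scaledConv (t * (1 / 2) ^ m) η v x) atTop (𝓝 L)) :
    dyadicPotential t Φ g x = scaledConv t η v x - L := by
  have hs : Summable fun m : ℕ =>
      (t * (1 / 2) ^ m) ^ 2 * scaledConv (t * (1 / 2) ^ m) Φ g x :=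
    .of_norm_bounded (summable_mul_half_pow_sq ht _)
      fun m => abs_dyadicPotential_term_le hΦ hg m x
  have hlim := tendsto_nhds_unique hs.hasSum.tendsto_sum_nat
    ((hL.const_sub (scaledConv t η v x)).congr fun N => ?_)
  · exact hlim
  · have := Finset.sum_range_sub' (fun m : ℕ => scaledConv (t * (1 / 2) ^ m) η v x) N
    rw [pow_zero, mul_one] at this
    rw [← this]
    refine Finset.sum_congr rfl fun m _ => ?_
    rw [← h m, pow_succ, ← mul_assoc, mul_one_div]

lemma exists_holderClass_ball (hn : 1 ≤ n) {k : ℕ} (hα : α ∈ Ioo (0 : ℝ) 1) (hΩ : IsOpen Ω)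
    (hf : HolderClass α Ω k f) (hu : LocallyIntegrableOn u Ω)
    (hdist : ∀ φ : 𝔼 n → ℝ, ContDiff ℝ (⊤ : ℕ∞) φ → HasCompactSupport φ → tsupport φ ⊆ Ω →
      ∫ x in Ω, u x * (∑ j, pd j (pd j φ) x) = ∫ x in Ω, f x * φ x)
    {x₀ : 𝔼 n} (hx₀ : x₀ ∈ Ω) : ∃ R > 0, ∃ v : 𝔼 n → ℝ,
      HolderClass α (Metric.ball x₀ R) (k + 2) v ∧ ∀ᵐ x, x ∈ Metric.ball x₀ R → v x = u x := by
  obtain ⟨Φ, η, hΦ, hη, hc, hΦη⟩ := exists_laplacian_eq_sub hn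
  obtain ⟨ε, hε, hεΩ⟩ := Metric.nhds_basis_closedBall.mem_iff.1 (hΩ.mem_nhds hx₀)
  obtain ⟨R, rfl⟩ : ∃ R, ε = 3 * R := ⟨ε / 3, by ring⟩
  have hR : 0 < R := by linarith
  let χ : ContDiffBump x₀ := ⟨2 * R, 3 * R, by linarith, by linarith⟩
  have hχt : tsupport χ ⊆ Ω := by rwa [χ.tsupport_eq]
  have hχ1 : ∀ y ∈ Metric.closedBall x₀ (2 * R), χ y = 1 := fun y => χ.one_of_mem_closedBall
  set g : 𝔼 n → ℝ := fun y => χ y * f y with hg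
  have hgH : HolderClass α univ k g := HolderClass.of_locally fun x _ => by
    by_cases hx : x ∈ tsupport χ
    · exact ⟨Ω, hΩ.mem_nhds (hχt hx), (HolderClass.of_contDiff hα χ.contDiff hΩ).mul hα hΩ hf⟩
    · have ho : IsOpen (tsupport χ)ᶜ := (isClosed_tsupport χ).isOpen_compl
      refine ⟨(tsupport χ)ᶜ, ho.mem_nhds hx,
        (HolderClass.of_contDiff (f := fun _ => 0) hα contDiff_const ho).congr ho fun y hy => ?_⟩
      simp only [hg, image_eq_zero_of_notMem_tsupport hy, zero_mul]
  have hgc : HasCompactSupport g := χ.hasCompactSupport.mul_right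
  obtain ⟨M, hM⟩ := (contDiffOn_univ.1 ((HolderClass.iff_pdIter hα.1 isOpen_univ).1
    hgH).1).continuous.bounded_above_of_compact_support hgc
  set w := (Metric.closedBall x₀ (2 * R)).indicator u with hw
  have hwi : LocallyIntegrable w :=
    ((integrable_indicator_iff measurableSet_closedBall).2 (hu.integrableOn_compact_subset
      ((Metric.closedBall_subset_closedBall (by linarith)).trans hεΩ)
      (isCompact_closedBall _ _))).locallyIntegrable
  have hb : IsOpen (Metric.ball x₀ R) := Metric.isOpen_ball
  refine ⟨R, hR, fun x => (∫ y, η y)⁻¹ * (scaledConv R η w x + -1 * dyadicPotential R Φ g x),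
    ?_, ?_⟩
  · have hconst : ∀ c : ℝ, HolderClass α (Metric.ball x₀ R) (k + 2) fun _ : 𝔼 n => c :=
      fun c => HolderClass.of_contDiff hα contDiff_const hb
    exact (hconst _).mul hα hb ((HolderClass.of_contDiff hα
      (contDiff_scaledConv hR hη.contDiff hη.hasCompactSupport hwi) hb).add hb
      ((hconst _).mul hα hb ((holderClass_dyadicPotential hα hR hΦ hgH hgc).mono
        (subset_univ _))))
  · filter_upwards [ae_tendsto_scaledConv hη hwi hR] with x hlim hx
    have hball : ∀ m : ℕ, Metric.closedBall x (R * (1 / 2) ^ m) ⊆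
        Metric.closedBall x₀ (2 * R) := fun m => by
      refine Metric.closedBall_subset_closedBall' ?_
      have h1 : R * (1 / 2 : ℝ) ^ m ≤ R :=
        mul_le_of_le_one_right hR.le (pow_le_one₀ (by norm_num) (by norm_num))
      linarith [Metric.mem_ball.1 hx]
    have hwx : w x = u x := indicator_of_mem
      (hball 0 (Metric.mem_closedBall_self (by positivity))) u
    rw [dyadicPotential_eq_sub hΦ hR hM (fun m => ?_) hlim, hwx]
    · field_simp
      ring
    · refine scaledConv_sub_scaledConv_half hΦ hη hΦη hdist (by positivity)
        ((hball m).trans ((Metric.closedBall_subset_closedBall (by linarith)).trans hεΩ)) hwi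
        (fun y hy => (indicator_of_mem (hball m hy) u).symm) fun y hy => ?_
      rw [hg]
      simp only [hχ1 y (hball m hy), one_mul]

end Poisson

lemma HolderClass.exists_of_locally_ae_eq {k : ℕ} (hα : 0 < α) {Ω : Set (𝔼 n)}
    (hΩ : IsOpen Ω) {u : 𝔼 n → ℝ}
    (h : ∀ x ∈ Ω, ∃ R > 0, ∃ v : 𝔼 n → ℝ, HolderClass α (Metric.ball x R) k v ∧
      ∀ᵐ y, y ∈ Metric.ball x R → v y = u y) :
    ∃ v : 𝔼 n → ℝ, HolderClass α Ω k v ∧ ∀ᵐ x, x ∈ Ω → v x = u x := by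
  choose! R hR v hv hvu using h
  have hcont : ∀ x ∈ Ω, ContinuousOn (v x) (Metric.ball x (R x)) := fun x hx =>
    ((HolderClass.iff_pdIter hα Metric.isOpen_ball).1 (hv x hx)).1.continuousOn
  have heq : ∀ x ∈ Ω, ∀ y ∈ Ω, EqOn (v x) (v y) (Metric.ball x (R x) ∩ Metric.ball y (R y)) := by
    intro x hx y hy
    have ho := (Metric.isOpen_ball (x := x) (ε := R x)).inter
      (Metric.isOpen_ball (x := y) (ε := R y))
    refine Measure.eqOn_open_of_ae_eq (μ := volume) ?_ ho
      ((hcont x hx).mono inter_subset_left) ((hcont y hy).mono inter_subset_right)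
    rw [EventuallyEq, ae_restrict_iff' ho.measurableSet]
    filter_upwards [hvu x hx, hvu y hy] with z h1 h2 hz
    rw [h1 hz.1, h2 hz.2]
  have hdiag : ∀ x ∈ Ω, EqOn (v x) (fun y => v y y) (Ω ∩ Metric.ball x (R x)) :=
    fun x hx y hy => heq x hx y hy.1 ⟨hy.2, Metric.mem_ball_self (hR y hy.1)⟩
  have hnhds : ∀ x ∈ Ω, Metric.ball x (R x) ∈ 𝓝 x := fun x hx => Metric.ball_mem_nhds x (hR x hx)
  refine ⟨fun y => v y y, HolderClass.of_locally fun x hx =>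
    ⟨_, inter_mem (hΩ.mem_nhds hx) (hnhds x hx), ((hv x hx).mono inter_subset_right).congr
      (hΩ.inter Metric.isOpen_ball) (hdiag x hx)⟩, ?_⟩
  rw [ae_iff]
  refine measure_null_of_locally_null _ fun x hx => ?_
  have hxΩ : x ∈ Ω := (Classical.not_imp.1 hx).1
  refine ⟨_, inter_mem_nhdsWithin _ (hnhds x hxΩ), measure_mono_null ?_ (ae_iff.1 (hvu x hxΩ))⟩
  rintro y ⟨hy, hyR⟩
  obtain ⟨hyΩ, hne⟩ := Classical.not_imp.1 hy
  exact Classical.not_imp.2 ⟨hyR, fun h => hne ((hdiag x hxΩ ⟨hyΩ, hyR⟩).symm.trans h)⟩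

end Regularity

/-- Hölder elliptic regularity for the Poisson equation. If `f` is `C^k` with
locally `α`-Hölder `k`-th derivatives on an open set `Ω` and `u` is a locally integrable
distributional solution of `Δu = f` on `Ω`, then `u` has a representative which is
`C^{k+2}` on `Ω` with locally `α`-Hölder derivatives of order `k+2`. -/
theorem poisson_holder_regularity
    (n : ℕ) (hn : 1 ≤ n) (k : ℕ) (α : ℝ) (hα : α ∈ Ioo (0:ℝ) 1)
    (Ω : Set (EuclideanSpace ℝ (Fin n))) (hΩ : IsOpen Ω)
    (f u : EuclideanSpace ℝ (Fin n) → ℝ)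
    (hf : ContDiffOn ℝ k f Ω)
    (hfH : ∀ l : List (Fin n), l.length = k → LocallyHolderOn α (pdIter l f) Ω)
    (hu : LocallyIntegrableOn u Ω volume)
    (hdist : ∀ φ : EuclideanSpace ℝ (Fin n) → ℝ, ContDiff ℝ (⊤ : ℕ∞) φ → HasCompactSupport φ →
      tsupport φ ⊆ Ω →
      ∫ x in Ω, u x * (∑ j, pd j (pd j φ) x) = ∫ x in Ω, f x * φ x) :
    ∃ uu : EuclideanSpace ℝ (Fin n) → ℝ,
      (∀ᵐ x : EuclideanSpace ℝ (Fin n) ∂volume, x ∈ Ω → uu x = u x) ∧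
      ContDiffOn ℝ (k + 2) uu Ω ∧
      ∀ l : List (Fin n), l.length = k + 2 → LocallyHolderOn α (pdIter l uu) Ω := by
  obtain ⟨uu, huu, hae⟩ := HolderClass.exists_of_locally_ae_eq hα.1 hΩ fun x hx =>
    exists_holderClass_ball hn hα hΩ ((HolderClass.iff_pdIter hα.1 hΩ).2 ⟨hf, hfH⟩) hu hdist hx
  obtain ⟨hd, hH⟩ := (HolderClass.iff_pdIter hα.1 hΩ).1 huu
  exact ⟨uu, hae, by exact_mod_cast hd, hH⟩
end
end
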